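/- For every rc-graph R satisfying condition (*) and all integers 0 < x < y ≤ z ≤ n, one has R ← yxz = R ← yzx; that is, inserting y, then x, then z produces the same rc-graph as inserting y, then z, then x. -/

import Mathlib

open scoped Classical

noncomputable section

namespace RCGraphs

/-- The simple transposition `s j`, interchanging `j` and `j+1`. -/
def sT (j : ℤ) : Equiv.Perm ℤ := Equiv.swap j (j + 1)

/-- The Coxeter length of a permutation of `ℤ`: the minimal length of an expression
as a product of simple transpositions. -/
def len (w : Equiv.Perm ℤ) : ℕ :=
  sInf {m : ℕ | ∃ l : List ℤ, l.length = m ∧ (l.map sT).prod = w}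

/-- The permutations considered in the paper: bijections of `ℤ` fixing every `i > n`
and fixing all sufficiently small integers. -/
def IsPermZ (n : ℤ) (w : Equiv.Perm ℤ) : Prop :=
  (∀ i : ℤ, n < i → w i = i) ∧ ∃ N : ℤ, ∀ i : ℤ, i < N → w i = i

/-- The reading order on positions `(i,k)`: rows (second coordinate) from `n` downward,
and within a row in order of increasing first coordinate. -/
def rcOrder (p q : ℤ × ℤ) : Prop :=
  q.2 < p.2 ∨ (p.2 = q.2 ∧ p.1 ≤ q.1)

instance : DecidableRel rcOrder := fun p q => by
  unfold rcOrder; infer_instance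

instance : IsTrans (ℤ × ℤ) rcOrder :=
  ⟨fun a b c h₁ h₂ => by unfold rcOrder at *; omega⟩

instance : IsAntisymm (ℤ × ℤ) rcOrder :=
  ⟨fun a b h₁ h₂ => by
    unfold rcOrder at *
    have h3 : a.1 = b.1 ∧ a.2 = b.2 := by omega
    exact Prod.ext h3.1 h3.2⟩

instance : IsTotal (ℤ × ℤ) rcOrder :=
  ⟨fun a b => by unfold rcOrder; omega⟩

/-- The permutation `w_R` associated to a finite set of positions `R`: the product of the
simple transpositions `s_{i+k-n-1}`, `(i,k) ∈ R`, in the reading order. -/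
def wR (n : ℤ) (R : Finset (ℤ × ℤ)) : Equiv.Perm ℤ :=
  ((R.sort rcOrder).map fun p => sT (p.1 + p.2 - n - 1)).prod

/-- `R` is an rc-graph: positions lie in the grid `{(i,k) : i ≤ n, k ≤ n}` and the
reading word is reduced. -/
def IsRC (n : ℤ) (R : Finset (ℤ × ℤ)) : Prop :=
  (∀ p ∈ R, p.1 ≤ n ∧ p.2 ≤ n) ∧ len (wR n R) = R.card

/-- Condition (*): `w_R(i) > w_R(i-1)` for all `i ≤ 0`; equivalently no two strands with
nonpositive labels cross. -/
def Star (n : ℤ) (R : Finset (ℤ × ℤ)) : Prop :=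
  ∀ i : ℤ, i ≤ 0 → wR n R (i - 1) < wR n R i

/-- Strand labels in the wiring diagram of `R` (for diagrams all of whose crossings lie in
rows `k ≥ 1`, as is the case under condition (*)).  `lab n R true i k` is the label of the
strand entering position `(i,k)` from the west (the strand passing above, if `(i,k)` is not
a crossing); `lab n R false i k` is the label of the strand entering from the south (the
strand passing below).  Each strand is labeled by the row where it begins. -/
def lab (n : ℤ) (R : Finset (ℤ × ℤ)) : Bool → ℤ → ℤ → ℤ
  | true, i, k =>
      if h : n ≤ i then k
      else if (i + 1, k) ∈ R then lab n R true (i + 1) k else lab n R false (i + 1) k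
  | false, i, k =>
      if h : k ≤ 0 then i + k - n - 1
      else if (i, k - 1) ∈ R then lab n R false i (k - 1) else lab n R true i (k - 1)
  termination_by b i k => ((n - i).toNat + k.toNat)
  decreasing_by
    all_goals simp_wf
    all_goals omega

/-- The label of the strand leaving position `(i,r)` northward. -/
def northLabel (n : ℤ) (R : Finset (ℤ × ℤ)) (i r : ℤ) : ℤ :=
  if (i, r) ∈ R then lab n R false i r else lab n R true i r

/-- `(i,k)` is an open space: not a crossing, the strand passing below it has a
nonpositive label and the strand passing above it has a positive label. -/
def OpenSpace (n : ℤ) (R : Finset (ℤ × ℤ)) (i k : ℤ) : Prop :=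
  i ≤ n ∧ (i, k) ∉ R ∧ lab n R false i k ≤ 0 ∧ 0 < lab n R true i k

/-- The main loop of the Bergeron--Billey insertion algorithm, recording the trace:
the list of pairs (current diagram, crossing just added).  `R` always contains the
crossing `p` that was just added. -/
def insertSteps (n : ℤ) : ℕ → Finset (ℤ × ℤ) → ℤ × ℤ → List (Finset (ℤ × ℤ) × (ℤ × ℤ))
  | 0, _, _ => []
  | fuel + 1, R, p =>
      (R, p) ::
        if IsRC n R then []
        else
          let a := lab n R true p.1 p.2
          let b := lab n R false p.1 p.2
          -- the unique other crossing of the two strands that cross at `p`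
          let C := R.filter fun q =>
            q ≠ p ∧ ((lab n R true q.1 q.2 = a ∧ lab n R false q.1 q.2 = b) ∨
                     (lab n R true q.1 q.2 = b ∧ lab n R false q.1 q.2 = a))
          let q := (C.sort rcOrder).headI
          let R' := R.erase q
          let i' := sInf {x : ℤ | q.1 < x ∧ OpenSpace n R' x q.2}
          insertSteps n fuel (insert (i', q.2) R') (i', q.2)

/-- The trace of the insertion of `k` into `R`: the states of the algorithm together with
the crossings added at each step. -/
def insertStepsOf (n : ℤ) (R : Finset (ℤ × ℤ)) (k : ℤ) : List (Finset (ℤ × ℤ) × (ℤ × ℤ)) :=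
  let i₁ := sInf {x : ℤ | OpenSpace n R x k}
  insertSteps n ((n + 1 - k).toNat + 1) (insert (i₁, k) R) (i₁, k)

/-- The insertion `R ← k` of Bergeron and Billey. -/
def insertOne (n : ℤ) (R : Finset (ℤ × ℤ)) (k : ℤ) : Finset (ℤ × ℤ) :=
  ((insertStepsOf n R k).getLast?.getD (R, (0, 0))).1

/-- The insertion `R ← v` of a word. -/
def insertWord (n : ℤ) (R : Finset (ℤ × ℤ)) (v : List ℕ) : Finset (ℤ × ℤ) :=
  v.foldl (fun S a => insertOne n S (a : ℤ)) R

/-- The column (first coordinate) at which the strand labeled `a` of the diagram `R`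
leaves row `r` northward. -/
def strandCol (n : ℤ) (R : Finset (ℤ × ℤ)) (a r : ℤ) : ℤ :=
  sSup {i : ℤ | i ≤ n ∧ northLabel n R i r = a}

/-- Given the trace `L` of an insertion, the column occupied in row `r` by the left path
(`left = true`) or the right path (`left = false`) of the insertion.  Between the rows of
the `t`-th and `(t+1)`-st added crossings, the left path is the piece `s_t` of the strand
whose label changes from `a_t` to `b_t`, and the right path is the piece `s^t` whose label
changes from `b_t` to `a_t`. -/
def pathCol (n : ℤ) (L : List (Finset (ℤ × ℤ) × (ℤ × ℤ))) (left : Bool) (r : ℤ) : ℤ :=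
  match (L.filter fun e => e.2.2 ≤ r).getLast? with
  | some e => strandCol n e.1 (lab n e.1 left e.2.1 e.2.2) r
  | none => 0

/-- A semistandard Young tableau with at most `n` rows (rows indexed `1,…,n`, row `j`
having `μ j` boxes, columns indexed from `0`), with entries in `{1,…,n}`, weakly
increasing along rows and strictly increasing down columns; entries outside the shape
are `0`. -/
structure SSYT (n : ℕ) (μ : ℕ → ℕ) where
  entry : ℕ → ℕ → ℕ
  entry_mem : ∀ j c, 1 ≤ j → j ≤ n → c < μ j → 1 ≤ entry j c ∧ entry j c ≤ n
  row_weak : ∀ j c₁ c₂, 1 ≤ j → j ≤ n → c₁ ≤ c₂ → c₂ < μ j → entry j c₁ ≤ entry j c₂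
  col_strict : ∀ j₁ j₂ c, 1 ≤ j₁ → j₁ < j₂ → j₂ ≤ n → c < μ j₂ → entry j₁ c < entry j₂ c
  outside : ∀ j c, j = 0 ∨ n < j ∨ μ j ≤ c → entry j c = 0

/-- `μ` is a partition with (at most) `n` parts `μ 1 ≥ μ 2 ≥ … ≥ μ n ≥ 0`
(and `μ j = 0` outside `1,…,n`). -/
def IsPartition (n : ℕ) (μ : ℕ → ℕ) : Prop :=
  (∀ j, 1 ≤ j → j < n → μ (j + 1) ≤ μ j) ∧ ∀ j, j = 0 ∨ n < j → μ j = 0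

/-- The reading word of a tableau: the rows read left to right, from the bottom row
to the top one. -/
def readingWord (n : ℕ) (μ : ℕ → ℕ) (Y : SSYT n μ) : List ℕ :=
  ((List.range n).reverse.map (· + 1)).flatMap fun j =>
    (List.range (μ j)).map fun c => Y.entry j c

/-- An elementary Knuth move. -/
def KnuthMove (w₁ w₂ : List ℕ) : Prop :=
  (∃ (u v : List ℕ) (x y z : ℕ), x < y ∧ y ≤ z ∧
      w₁ = u ++ y :: x :: z :: v ∧ w₂ = u ++ y :: z :: x :: v) ∨
  (∃ (u v : List ℕ) (x y z : ℕ), x ≤ y ∧ y < z ∧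
      w₁ = u ++ x :: z :: y :: v ∧ w₂ = u ++ z :: x :: y :: v)

/-- Knuth equivalence: the equivalence relation generated by elementary Knuth moves. -/
def KnuthEquiv (w₁ w₂ : List ℕ) : Prop := Relation.EqvGen KnuthMove w₁ w₂

/-- The monomial `x^R = ∏_{(i,k) ∈ R} x_k`. -/
def xR (R : Finset (ℤ × ℤ)) : MvPolynomial ℕ ℤ :=
  ∏ p ∈ R, MvPolynomial.X p.2.toNat

/-- The monomial `x^Y = ∏ x_i`, one factor for each entry `i` of `Y`. -/
def xY (n : ℕ) (μ : ℕ → ℕ) (Y : SSYT n μ) : MvPolynomial ℕ ℤ :=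
  ((readingWord n μ Y).map MvPolynomial.X).prod

/-- The Schubert polynomial `S_w = Σ_{R : w_R = w} x^R`. -/
def Schub (n : ℤ) (w : Equiv.Perm ℤ) : MvPolynomial ℕ ℤ :=
  ∑ᶠ R ∈ {R : Finset (ℤ × ℤ) | IsRC n R ∧ wR n R = w}, xR R

/-- The Schur polynomial `s_μ(x₁,…,x_n) = Σ_Y x^Y`, summing over all semistandard Young
tableaux of shape `μ` with entries in `{1,…,n}`. -/
def SchurP (n : ℕ) (μ : ℕ → ℕ) : MvPolynomial ℕ ℤ :=
  ∑ᶠ Y : SSYT n μ, xY n μ Y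

/-- The complete homogeneous symmetric polynomial
`h_m = Σ_{1 ≤ i₁ ≤ … ≤ i_m ≤ n} x_{i₁} ⋯ x_{i_m}`. -/
def hPoly (n m : ℕ) : MvPolynomial ℕ ℤ :=
  ∑ s ∈ (Finset.Icc 1 n).sym m, (s.1.map MvPolynomial.X).prod

/-- The top rc-graph `R(μ) = {(i,k) : 1 ≤ k ≤ n, n - μ_k + 1 ≤ i ≤ n}` of a partition. -/
def Rmu (n : ℕ) (μ : ℕ → ℕ) : Finset (ℤ × ℤ) :=
  (Finset.Icc 1 (n : ℤ)).biUnion fun k =>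
    (Finset.Icc ((n : ℤ) - μ k.toNat + 1) (n : ℤ)).image fun i => (i, k)


/-- A row of the wiring diagram: `u` south labels, `W` west labels, `o` north labels. -/
structure Row (S : ℕ → Prop) (u W o : ℕ → ℤ) : Prop where
  w : ∀ m, W (m + 1) = if S m then W m else u m
  o : ∀ m, o m = if S m then u m else W m

/-- all crossings in the row are good -/
def GoodRow (S : ℕ → Prop) (u W : ℕ → ℤ) : Prop := ∀ m, S m → u m < W m ∧ 0 < W m

structure SwapRel (u u' : ℕ → ℤ) (p q : ℕ) : Prop where
  lt : p < q
  pos : 0 < u p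
  np : u q ≤ 0
  btw : ∀ m, p < m → m < q → u p < u m
  ep : u' p = u q
  eq : u' q = u p
  ne : ∀ m, m ≠ p → m ≠ q → u' m = u m

def sh (S : ℕ → Prop) (p : ℕ) : ℕ := if S p then p else p + 1

def Bump (S : ℕ → Prop) (p q : ℕ) : Prop := ¬ S p ∧ S q ∧ q = p + 1

/-- one row step of the insertion -/
def RowStep (W : ℕ → ℤ) (S : ℕ → Prop) (p q : ℕ) (S' : ℕ → Prop) (p' q' : ℕ) : Prop :=
  (¬ Bump S p q ∧ (∀ m, S' m ↔ S m) ∧ p' = sh S p ∧ q' = sh S q) ∨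
  (Bump S p q ∧ p' ≤ p ∧ 0 < W p' ∧ (∀ m, p' < m → m ≤ p → W m ≤ 0) ∧ q' = p' + 1 ∧
    ∀ m, S' m ↔ (S m ∧ m ≠ q) ∨ m = p')

def Create (W : ℕ → ℤ) (S S' : ℕ → Prop) (p' q' : ℕ) : Prop :=
  0 < W p' ∧ (∀ m, p' < m → W m ≤ 0) ∧ q' = p' + 1 ∧ ∀ m, S' m ↔ S m ∨ m = p'

theorem Row.cross {S u W o} (h : Row S u W o) {m} (hm : S m) : W (m + 1) = W m ∧ o m = u m := by
  have := h.w m; have := h.o m; simp_all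

theorem Row.elbow {S u W o} (h : Row S u W o) {m} (hm : ¬ S m) : W (m + 1) = u m ∧ o m = W m := by
  have := h.w m; have := h.o m; simp_all

/-- congruence: rows agreeing up to `p` -/
theorem Row.prefix_eq {S u W o S' u' W' o'} (h : Row S u W o) (h' : Row S' u' W' o')
    (h0 : W' 0 = W 0) (p : ℕ) (hS : ∀ m < p, (S' m ↔ S m)) (hu : ∀ m < p, u' m = u m) :
    (∀ m ≤ p, W' m = W m) ∧ (∀ m < p, o' m = o m) := by
  have key : ∀ m ≤ p, W' m = W m := by
    intro m
    induction m with
    | zero => intro _; exact h0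
    | succ m ih =>
      intro hm
      rw [h.w, h'.w, ih (by omega), hu m (by omega)]
      simp only [hS m (by omega)]
  refine ⟨key, fun m hm => ?_⟩
  rw [h.o, h'.o, key m hm.le, hu m hm]
  simp only [hS m hm]

/-- congruence: rows agreeing from `p` on -/
theorem Row.suffix_eq {S u W o S' u' W' o'} (h : Row S u W o) (h' : Row S' u' W' o')
    (p : ℕ) (h0 : W' p = W p) (hS : ∀ m ≥ p, (S' m ↔ S m)) (hu : ∀ m ≥ p, u' m = u m) :
    (∀ m ≥ p, W' m = W m) ∧ (∀ m ≥ p, o' m = o m) := by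
  have key : ∀ m ≥ p, W' m = W m := by
    intro m hm
    induction m, hm using Nat.le_induction with
    | base => exact h0
    | succ m hm ih =>
      rw [h.w, h'.w, ih, hu m hm]
      simp only [hS m hm]
  refine ⟨key, fun m hm => ?_⟩
  rw [h.o, h'.o, key m hm, hu m hm]
  simp only [hS m hm]

/-- general: middle segments agree -/
theorem Row.seg_eq {S u W o S' u' W' o'} (h : Row S u W o) (h' : Row S' u' W' o')
    (p q : ℕ) (h0 : W' p = W p) (hS : ∀ m, p ≤ m → m < q → (S' m ↔ S m))
    (hu : ∀ m, p ≤ m → m < q → u' m = u m) :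
    (∀ m, p ≤ m → m ≤ q → W' m = W m) ∧ (∀ m, p ≤ m → m < q → o' m = o m) := by
  have key : ∀ m, p ≤ m → m ≤ q → W' m = W m := by
    intro m hm
    induction m, hm using Nat.le_induction with
    | base => intro _; exact h0
    | succ m hm ih =>
      intro hq
      rw [h.w, h'.w, ih (by omega), hu m hm (by omega)]
      simp only [hS m hm (by omega)]
  refine ⟨key, fun m hm hq => ?_⟩
  rw [h.o, h'.o, key m hm hq.le, hu m hm hq]
  simp only [hS m hm hq]

/-- after an elbow with nonpositive south label there is another elbow -/
theorem GoodRow.elbow_next {S u W o} (hg : GoodRow S u W) (h : Row S u W o) {q}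
    (hq : ¬ S q) (hn : u q ≤ 0) : ¬ S (q + 1) := by
  intro hs
  have := (hg _ hs).2
  rw [(h.elbow hq).1] at this
  omega

theorem elbow_p {S u W o} (hg : GoodRow S u W) (h : Row S u W o) {p q}
    (hpq : p < q) (hb : ∀ m, p < m → m < q → u p < u m)
    (hnb : ¬ Bump S p q) (hp : ¬ S p) : ¬ S (p + 1) := by
  intro hs
  by_cases hq : q = p + 1
  · exact hnb ⟨hp, hq ▸ hs, hq⟩
  · have h1 := hb (p + 1) (by omega) (by omega)
    have h2 := (hg _ hs).1
    rw [(h.elbow hp).1] at h2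
    omega

/-- Evolution of a swapped pair through a row without bump. -/
theorem nobump {S u W o u' W' o' p q} (hg : GoodRow S u W) (h : Row S u W o)
    (h' : Row S u' W' o') (h0 : W' 0 = W 0) (hs : SwapRel u u' p q) (hnb : ¬ Bump S p q) :
    SwapRel o o' (sh S p) (sh S q) ∧ GoodRow S u' W' ∧ (∀ m ≤ p, W' m = W m) ∧
      (∀ m, sh S q < m → W' m = W m) := by
  obtain ⟨hlt, hpos, hnp, hbt, hep, heq, hne⟩ := hs
  have pre := h.prefix_eq h' h0 p (fun _ _ => Iff.rfl) (fun m hm => hne m (by omega) (by omega))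
  have hWp := pre.1 p le_rfl
  -- facts at p
  have Ep : ¬ S p → ¬ S (p + 1) := elbow_p hg h hlt hbt hnb
  have Eq : ¬ S q → ¬ S (q + 1) := fun hq => hg.elbow_next h hq hnp
  -- carries strictly between exceed a
  have hWbt : ∀ m, p + 1 < m → m ≤ q → u p < W m := by
    intro m hm
    induction m, hm using Nat.le_induction with
    | base =>
      intro hq
      by_cases hp1 : S (p + 1)
      · have hp : S p := by by_contra hp; exact Ep hp hp1
        rw [(h.cross hp1).1, (h.cross hp).1]; exact (hg _ hp).1
      · rw [(h.elbow hp1).1]; exact hbt _ (by omega) (by omega)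
    | succ m hm ih =>
      intro hq
      by_cases hp1 : S m
      · rw [(h.cross hp1).1]; exact ih (by omega)
      · rw [(h.elbow hp1).1]; exact hbt _ (by omega) (by omega)
  -- carries at p+1
  have hWp1 : S p → W' (p + 1) = W (p + 1) := by
    intro hp; rw [(h.cross hp).1, (h'.cross hp).1, hWp]
  have hmid : p + 1 < q → W' (p + 2) = W (p + 2) := by
    intro hq
    by_cases hp1 : S (p + 1)
    · have hp : S p := by by_contra hp; exact Ep hp hp1
      rw [(h.cross hp1).1, (h'.cross hp1).1, hWp1 hp]
    · rw [(h.elbow hp1).1, (h'.elbow hp1).1, hne _ (by omega) (by omega)]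
  have seg := fun hq : p + 1 < q => h.seg_eq h' (p + 2) q (hmid hq) (fun _ _ _ => Iff.rfl)
    (fun m _ _ => hne m (by omega) (by omega))
  have hWq : (S p ∨ p + 1 < q) → W' q = W q := by
    intro hh
    by_cases hq : p + 1 < q
    · exact (seg hq).1 q (by omega) le_rfl
    · have : q = p + 1 := by omega
      subst this
      exact hWp1 (by tauto)
  have hSq : S q → (S p ∨ p + 1 < q) := by
    intro h1; by_contra hc; push Not at hc
    exact hnb ⟨hc.1, h1, by omega⟩
  have hWqa : S q → u p < W q := by
    intro h1
    rcases Nat.lt_or_ge (p + 1) q with h2 | h2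
    · exact hWbt q h2 le_rfl
    · have : q = p + 1 := by omega
      subst this
      have hp : S p := by rcases hSq h1 with h | h; exact h; omega
      rw [(h.cross hp).1]; exact (hg _ hp).1
  have hsuf0 : W' (sh S q + 1) = W (sh S q + 1) := by
    unfold sh
    by_cases hq : S q
    · rw [if_pos hq, (h.cross hq).1, (h'.cross hq).1, hWq (hSq hq)]
    · rw [if_neg hq, (h.elbow (Eq hq)).1, (h'.elbow (Eq hq)).1, hne _ (by omega) (by omega)]
  have hshq : q ≤ sh S q := by unfold sh; split_ifs <;> omega
  have suf := h.suffix_eq h' (sh S q + 1) hsuf0 (fun _ _ => Iff.rfl)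
    (fun m hm => hne m (by omega) (by omega))
  -- outputs
  have op : o (sh S p) = u p ∧ o' (sh S p) = u q := by
    unfold sh
    by_cases hp : S p
    · rw [if_pos hp, (h.cross hp).2, (h'.cross hp).2]; exact ⟨rfl, hep⟩
    · rw [if_neg hp, (h.elbow (Ep hp)).2, (h'.elbow (Ep hp)).2, (h.elbow hp).1, (h'.elbow hp).1]
      exact ⟨rfl, hep⟩
  have oq : o (sh S q) = u q ∧ o' (sh S q) = u p := by
    unfold sh
    by_cases hp : S q
    · rw [if_pos hp, (h.cross hp).2, (h'.cross hp).2]; exact ⟨rfl, heq⟩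
    · rw [if_neg hp, (h.elbow (Eq hp)).2, (h'.elbow (Eq hp)).2, (h.elbow hp).1, (h'.elbow hp).1]
      exact ⟨rfl, heq⟩
  refine ⟨⟨?_, ?_, ?_, ?_, ?_, ?_, ?_⟩, ?_, pre.1, fun m hm => suf.1 m (by omega)⟩
  · unfold sh
    by_cases hp : S p <;> by_cases hq : S q <;> simp only [hp, hq, if_true, if_false] <;> try omega
    rcases hSq hq with h1 | h1
    · exact absurd h1 hp
    · omega
  · rw [op.1]; exact hpos
  · rw [oq.1]; exact hnp
  · intro m hm1 hm2
    rw [op.1]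
    have hm1' : p < m := by revert hm1; unfold sh; split_ifs <;> omega
    by_cases hm : S m
    · rw [(h.cross hm).2]
      have : m ≠ q := by
        rintro rfl
        simp [sh, hm] at hm2
      have : m < q := by revert hm2; unfold sh; split_ifs <;> omega
      exact hbt m hm1' this
    · rw [(h.elbow hm).2]
      have hmq : m ≤ q := by revert hm2; unfold sh; split_ifs <;> omega
      rcases Nat.lt_or_ge (p + 1) m with h2 | h2
      · exact hWbt m h2 hmq
      · have : m = p + 1 := by omega
        subst this
        have hp : S p := by
          by_contra hp
          simp [sh, hp] at hm1
        rw [(h.cross hp).1]; exact (hg _ hp).1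
  · rw [op.2, oq.1]
  · rw [oq.2, op.1]
  · intro m hm1 hm2
    rcases Nat.lt_or_ge m p with h1 | h1
    · exact pre.2 m h1
    rcases Nat.lt_or_ge (sh S q) m with h2 | h2
    · exact suf.2 m (by omega)
    by_cases hmp : m = p
    · subst hmp
      have hp : ¬ S m := by intro hp; simp [sh, hp] at hm1
      rw [(h.elbow hp).2, (h'.elbow hp).2, hWp]
    by_cases hmq : m = q
    · subst hmq
      have hq : ¬ S m := by intro hp; simp [sh, hp] at hm2
      rw [(h.elbow hq).2, (h'.elbow hq).2]
      apply hWq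
      by_contra hc; push Not at hc
      have : m = p + 1 := by omega
      simp [sh, hc.1] at hm1
      omega
    have hmq' : m < q := by revert h2 hm2; unfold sh; split_ifs <;> omega
    rcases Nat.lt_or_ge (p + 1) m with h3 | h3
    · exact (seg (by omega)).2 m (by omega) hmq'
    · have : m = p + 1 := by omega
      subst this
      have hp : S p := by
        by_contra hp
        simp [sh, hp] at hm1
      rw [h.o, h'.o, hWp1 hp, hne _ hmp hmq]
  · intro m hm
    have gm := hg m hm
    rcases Nat.lt_or_ge m p with h1 | h1
    · rw [pre.1 m h1.le, hne m (by omega) (by omega)]; exact gm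
    rcases Nat.lt_or_ge (sh S q) m with h2 | h2
    · rw [suf.1 m (by omega), hne m (by omega) (by omega)]; exact gm
    by_cases hmp : m = p
    · subst hmp
      rw [hWp, hep]; exact ⟨by omega, gm.2⟩
    by_cases hmq : m = q
    · subst hmq
      rw [hWq (hSq hm), heq]; exact ⟨hWqa hm, gm.2⟩
    have hmq' : m < q := by
      by_contra hc
      have hq : ¬ S q := by intro hq; simp [sh, hq] at h2; omega
      have : m = q + 1 := by simp [sh, hq] at h2; omega
      exact Eq hq (this ▸ hm)
    rcases Nat.lt_or_ge (p + 1) m with h3 | h3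
    · rw [(seg (by omega)).1 m (by omega) (by omega), hne m hmp hmq]; exact gm
    · have : m = p + 1 := by omega
      subst this
      have hp : S p := by by_contra hp; exact Ep hp hm
      rw [hWp1 hp, hne _ hmp hmq]; exact gm

/-- Removing the second crossing at a bump. -/
theorem bump_remove {S u W o S' u' W' o' p q} (hg : GoodRow S u W) (h : Row S u W o)
    (h' : Row S' u' W' o') (h0 : W' 0 = W 0) (hs : SwapRel u u' p q) (hb : Bump S p q)
    (hS : ∀ m, S' m ↔ S m ∧ m ≠ q) :
    (∀ m, o' m = o m) ∧ GoodRow S' u' W' ∧ (∀ m ≤ p, W' m = W m) ∧ (∀ m > q, W' m = W m) := by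
  obtain ⟨hlt, hpos, hnp, hbt, hep, heq, hne⟩ := hs
  obtain ⟨hp, hq, rfl⟩ := hb
  have pre := h.prefix_eq h' h0 p (fun m hm => by rw [hS]; constructor; tauto; intro h; exact ⟨h, by omega⟩) (fun m hm => hne m (by omega) (by omega))
  have hp' : ¬ S' p := by rw [hS]; tauto
  have hq' : ¬ S' (p + 1) := by rw [hS]; tauto
  have e1 := h.elbow hp
  have e2 := h.cross hq
  have e1' := h'.elbow hp'
  have e2' := h'.elbow hq'
  have hW2 : W' (p + 2) = W (p + 2) := by
    rw [e2.1, e1.1, e2'.1, heq]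
  have suf := h.suffix_eq h' (p + 2) hW2 (fun m hm => by rw [hS]; constructor; tauto; intro h; exact ⟨h, by omega⟩) (fun m hm => hne m (by omega) (by omega))
  refine ⟨?_, ?_, pre.1, fun m hm => suf.1 m (by omega)⟩
  · intro m
    rcases Nat.lt_or_ge m p with h1 | h1
    · exact pre.2 m h1
    rcases Nat.lt_or_ge (p + 1) m with h2 | h2
    · exact suf.2 m (by omega)
    rcases (by omega : m = p ∨ m = p + 1) with rfl | rfl
    · rw [e1.2, e1'.2, pre.1 m le_rfl]
    · rw [e2.2, e2'.2, e1'.1, hep]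
  · intro m hm
    rw [hS] at hm
    have gm := hg m hm.1
    have hmp : m ≠ p := by rintro rfl; tauto
    rw [hne m hmp hm.2]
    rcases Nat.lt_or_ge m p with h1 | h1
    · rw [pre.1 m h1.le]; exact gm
    · rw [suf.1 m (by omega)]; exact gm

/-- Adding a crossing at an open space. -/
theorem add_cross {S u W o S' W' o' j} (hg : GoodRow S u W) (h : Row S u W o)
    (h' : Row S' u W' o') (h0 : W' 0 = W 0) (hj : ¬ S j) (hWj : 0 < W j) (huj : u j ≤ 0)
    (hS : ∀ m, S' m ↔ S m ∨ m = j) :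
    SwapRel o o' j (j + 1) ∧ GoodRow S' u W' ∧ (∀ m ≤ j, W' m = W m) ∧
      (∀ m > j + 1, W' m = W m) := by
  have pre := h.prefix_eq h' h0 j (fun m hm => by rw [hS]; constructor; (rintro (h | h); exact h; omega); tauto) (fun m hm => rfl)
  have hj' : S' j := by rw [hS]; tauto
  have hj1 : ¬ S (j + 1) := hg.elbow_next h hj huj
  have hj1' : ¬ S' (j + 1) := by rw [hS]; rintro (h | h); exact hj1 h; omega
  have e1 := h.elbow hj
  have e2 := h.elbow hj1
  have e1' := h'.cross hj'
  have e2' := h'.elbow hj1'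
  have suf := h.suffix_eq h' (j + 2) (by rw [e2.1, e2'.1]) (fun m hm => by rw [hS]; constructor; (rintro (h | h); exact h; omega); tauto) (fun m hm => rfl)
  have hWj' := pre.1 j le_rfl
  refine ⟨⟨by omega, ?_, ?_, fun m _ _ => by omega, ?_, ?_, ?_⟩, ?_, pre.1, fun m hm => suf.1 m (by omega)⟩
  · rw [e1.2]; exact hWj
  · rw [e2.2, e1.1]; exact huj
  · rw [e1'.2, e2.2, e1.1]
  · rw [e2'.2, e1'.1, e1.2, hWj']
  · intro m h1 h2
    rcases Nat.lt_or_ge m j with h1 | h1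
    · exact pre.2 m h1
    · exact suf.2 m (by omega)
  · intro m hm
    rw [hS] at hm
    rcases hm with hm | rfl
    · have gm := hg m hm
      rcases Nat.lt_or_ge m j with h1 | h1
      · rw [pre.1 m h1.le]; exact gm
      · have : m ≠ j := by rintro rfl; tauto
        have : m ≠ j + 1 := by rintro rfl; tauto
        rw [suf.1 m (by omega)]; exact gm
    · rw [hWj']; exact ⟨by omega, hWj⟩



def mkW (S : ℕ → Prop) (u : ℕ → ℤ) (c : ℤ) : ℕ → ℤ
  | 0 => c
  | m + 1 => if S m then mkW S u c m else u m

def mkO (S : ℕ → Prop) (u : ℕ → ℤ) (c : ℤ) (m : ℕ) : ℤ := if S m then u m else mkW S u c m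

theorem mkRow (S : ℕ → Prop) (u : ℕ → ℤ) (c : ℤ) : Row S u (mkW S u c) (mkO S u c) :=
  ⟨fun _ => rfl, fun _ => rfl⟩

theorem Create.open_space {S u W o S' p' q'} (h : Row S u W o) (hc : Create W S S' p' q') :
    ¬ S p' ∧ u p' ≤ 0 := by
  obtain ⟨h1, h2, rfl, h4⟩ := hc
  have h3 := h2 (p' + 1) (by omega)
  have : ¬ S p' := by
    intro hs; rw [(h.cross hs).1] at h3; omega
  refine ⟨this, ?_⟩
  rw [(h.elbow this).1] at h3; exact h3

theorem row_create {S u W o S' W' o' p' q'} (hg : GoodRow S u W) (h : Row S u W o)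
    (h' : Row S' u W' o') (h0 : W' 0 = W 0) (hc : Create W S S' p' q') :
    SwapRel o o' p' q' ∧ GoodRow S' u W' ∧ (∀ m ≤ p', W' m = W m) ∧
      (∀ m > q', W' m = W m) := by
  have ho := hc.open_space h
  obtain ⟨h1, h2, rfl, h4⟩ := hc
  exact add_cross hg h h' h0 ho.1 h1 ho.2 h4

theorem bump_open {S u W o u' p q p'} (h : Row S u W o)
    (hs : SwapRel u u' p q) (hb : Bump S p q)
    (hle : p' ≤ p) (h1 : 0 < W p') (h2 : ∀ m, p' < m → m ≤ p → W m ≤ 0) :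
    ¬ S p' ∧ u' p' ≤ 0 := by
  rcases Nat.lt_or_ge p' p with hlt | hge
  · have h3 := h2 (p' + 1) (by omega) (by omega)
    have : ¬ S p' := by
      intro hs; rw [(h.cross hs).1] at h3; omega
    refine ⟨this, ?_⟩
    rw [(h.elbow this).1] at h3
    rw [hs.ne p' (by omega) (by have := hs.lt; omega)]; exact h3
  · obtain rfl : p' = p := by omega
    exact ⟨hb.1, by rw [hs.ep]; exact hs.np⟩

theorem row_step {S u W o S' u' W' o' p q p' q'} (hg : GoodRow S u W) (h : Row S u W o)
    (h' : Row S' u' W' o') (h0 : W' 0 = W 0) (hs : SwapRel u u' p q)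
    (hr : RowStep W S p q S' p' q') :
    SwapRel o o' p' q' ∧ GoodRow S' u' W' ∧ (∀ m, m ≤ p → m ≤ p' → W' m = W m) ∧
      (∀ m, m > q → m > q' → W' m = W m) := by
  rcases hr with ⟨hnb, hS, rfl, rfl⟩ | ⟨hb, hle, h1, h2, rfl, hS⟩
  · obtain rfl : S' = S := funext fun m => propext (hS m)
    have := nobump hg h h' h0 hs hnb
    exact ⟨this.1, this.2.1, fun m hm _ => this.2.2.1 m hm, fun m _ hm => this.2.2.2 m hm⟩
  · have hop := bump_open h hs hb hle h1 h2
    have R2 := mkRow (fun m => S m ∧ m ≠ q) u' (W 0)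
    have key := bump_remove hg h R2 rfl hs hb (fun m => Iff.rfl)
    have hoo : mkO (fun m => S m ∧ m ≠ q) u' (W 0) = o := funext key.1
    have key2 := add_cross (j := p') key.2.1 R2 h' h0 (by simp; tauto)
      (by rw [key.2.2.1 p' hle]; exact h1) hop.2 hS
    rw [hoo] at key2
    refine ⟨key2.1, key2.2.1, ?_, ?_⟩
    · intro m hm hm'
      rw [key2.2.2.1 m hm', key.2.2.1 m hm]
    · intro m hm hm'
      rw [key2.2.2.2 m hm', key.2.2.2 m hm]

/-- next nonpositive position after `p2` is at most any nonpositive position -/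
theorem SwapRel.q_le {u u' p q} (hs : SwapRel u u' p q) {j} (hj : p < j) (hu : u j ≤ 0) : q ≤ j := by
  by_contra hc
  have := hs.btw j hj (by omega)
  have := hs.pos
  omega

theorem q_bound {W S p q S' p' q' j} (hr : RowStep W S p q S' p' q') (hlt : p < q) (hq : q ≤ j)
    (hj : q = j → S j) : q' ≤ j := by
  rcases hr with ⟨hnb, hS, rfl, rfl⟩ | ⟨hb, hle, h1, h2, rfl, hS⟩
  · unfold sh
    split_ifs with h
    · exact hq
    · have : q ≠ j := by rintro rfl; exact h (hj rfl)
      omega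
  · omega

theorem c1_create {S u W o S1 W1 S12 u2 p1' q1' p2 q2 p2' q2'} (h : Row S u W o)
    (hc : Create W S S1 p1' q1')
    (hs2 : SwapRel u u2 p2 q2) (hr2 : RowStep W1 S1 p2 q2 S12 p2' q2') (hg : GoodRow S u W) :
    q2' ≤ p1' := by
  have ho := hc.open_space h
  obtain ⟨h1, h2, rfl, h4⟩ := hc
  have hu : ∀ m ≥ p1', u m ≤ 0 := by
    intro m hm
    by_cases hS : S m
    · rcases Nat.lt_or_ge p1' m with h5 | h5
      · have := h2 m h5
        have := hg m hS
        omega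
      · obtain rfl : p1' = m := by omega
        exact ho.2
    · have := h2 (m + 1) (by omega)
      rw [(h.elbow hS).1] at this; exact this
  have hp2 : p2 < p1' := by
    by_contra hc
    have := hu p2 (by omega)
    have := hs2.pos
    omega
  exact q_bound hr2 hs2.lt (hs2.q_le hp2 ho.2) (fun _ => (h4 _).2 (Or.inr rfl))

theorem c1_step {S u W o S1 u1 W1 S12 u12 p1 q1 p1' q1' p2 q2 p2' q2'} (h : Row S u W o)
    (hs1 : SwapRel u u1 p1 q1) (hr1 : RowStep W S p1 q1 S1 p1' q1')
    (hs2 : SwapRel u1 u12 p2 q2) (hr2 : RowStep W1 S1 p2 q2 S12 p2' q2')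
    (hle : q2 ≤ p1) (hg : GoodRow S u W) : q2' ≤ p1' := by
  rcases hr1 with ⟨hnb, hS, rfl, rfl⟩ | ⟨hb, hle1, h1, h2, rfl, hS⟩
  · apply q_bound hr2 hs2.lt
    · unfold sh; split_ifs <;> omega
    · intro hq
      rw [hS]
      revert hq
      unfold sh
      split_ifs with h5
      · intro _; exact h5
      · intro; omega
  · have hop := bump_open h hs1 hb hle1 h1 h2
    have hp2 : p2 < p1' := by
      by_contra hc
      have hlt := hs2.lt
      have h3 : u1 p2 ≤ 0 := by
        rcases Nat.eq_or_lt_of_le (by omega : p1' ≤ p2) with h4 | h4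
        · rw [← h4]; exact hop.2
        · rw [hs1.ne p2 (by omega) (by have := hs1.lt; omega)]
          have h6 := h2 (p2 + 1) (by omega) (by omega)
          have h7 := h2 p2 (by omega) (by omega)
          have : ¬ S p2 := fun h8 => by have := (hg _ h8).2; omega
          rw [(h.elbow this).1] at h6; exact h6
      have := hs2.pos
      omega
    exact q_bound hr2 hs2.lt (hs2.q_le hp2 hop.2) (fun _ => (hS _).2 (Or.inr rfl))

theorem W_pos_of_out {S u W o} (h : Row S u W o) (hg : GoodRow S u W) {m} (hm : 0 < o m) :
    0 < W m := by
  by_cases hS : S m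
  · exact (hg _ hS).2
  · rw [(h.elbow hS).2] at hm; exact hm

theorem c2_create {S1 u1 W1 o o1 S13 p1' q1' p3' q3'} (h1 : Row S1 u1 W1 o1)
    (hg1 : GoodRow S1 u1 W1) (hs : SwapRel o o1 p1' q1') (hc : Create W1 S1 S13 p3' q3') :
    q1' ≤ p3' := by
  by_contra hlt
  have := hc.2.1 q1' (by omega)
  have := W_pos_of_out h1 hg1 (m := q1') (by rw [hs.eq]; exact hs.pos)
  omega

theorem c2_step {S u W o S1 u1 W1 o1 S13 p1 q1 p1' q1' p3 q3 p3' q3'} (h : Row S u W o)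
    (hg : GoodRow S u W) (h1 : Row S1 u1 W1 o1) (hg1 : GoodRow S1 u1 W1)
    (hs1 : SwapRel u u1 p1 q1) (hr1 : RowStep W S p1 q1 S1 p1' q1') (hso : SwapRel o o1 p1' q1')
    (hr3 : RowStep W1 S1 p3 q3 S13 p3' q3') (hle : q1 ≤ p3) : q1' ≤ p3' := by
  have hW : 0 < W1 q1' := W_pos_of_out h1 hg1 (m := q1') (by rw [hso.eq]; exact hso.pos)
  rcases hr3 with ⟨hnb, hS3, rfl, rfl⟩ | ⟨hb, hle3, h31, h32, rfl, hS3⟩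
  · rcases hr1 with ⟨hnb1, hS, rfl, rfl⟩ | ⟨hb1, hle1, h11, h12, rfl, hS⟩
    · obtain rfl : S1 = S := funext fun m => propext (hS m)
      by_cases hq : q1 = p3
      · rw [hq]
      · unfold sh; split_ifs <;> omega
    · have := hb1.2.2
      unfold sh; split_ifs <;> omega
  · have hq : q1' ≤ p3 := by
      rcases hr1 with ⟨hnb1, hS, rfl, rfl⟩ | ⟨hb1, hle1, h11, h12, rfl, hS⟩
      · obtain rfl : S1 = S := funext fun m => propext (hS m)
        unfold sh
        split_ifs with h5
        · omega
        · have : q1 ≠ p3 := by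
            rintro rfl
            have := hg.elbow_next h h5 hs1.np
            exact this (hb.2.2 ▸ hb.2.1)
          omega
      · have := hb1.2.2
        omega
    by_contra hc
    have := h32 q1' (by omega) hq
    omega

theorem det_step {W S p q S' p' q' V T T' p'' q''} (h : RowStep W S p q S' p' q')
    (h' : RowStep V T p q T' p'' q'') (hp : T p ↔ S p) (hq : T q ↔ S q)
    (hW : Bump S p q → ∀ m, p' ≤ m → m ≤ p → V m = W m) : p'' = p' ∧ q'' = q' := by
  have hB : Bump T p q ↔ Bump S p q := by unfold Bump; rw [hp, hq]
  rcases h with ⟨hnb, hS, rfl, rfl⟩ | ⟨hb, hle, h1, h2, rfl, hS⟩ <;>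
  rcases h' with ⟨hnb', hS', rfl, rfl⟩ | ⟨hb', hle', h1', h2', rfl, hS'⟩
  · unfold sh; simp only [hp, hq]; exact ⟨trivial, trivial⟩
  · tauto
  · tauto
  · have hW := hW hb
    have : p'' = p' := by
      rcases Nat.lt_trichotomy p'' p' with h5 | h5 | h5
      · have := h2' p' h5 hle
        have := hW p' le_rfl hle
        omega
      · exact h5
      · have := h2 p'' h5 hle'
        have := hW p'' h5.le hle'
        omega
    omega

theorem det_create {W S S' p' q' V T T' p'' q''} (h : Create W S S' p' q')
    (h' : Create V T T' p'' q'') (hW : ∀ m, p' ≤ m → V m = W m) : p'' = p' ∧ q'' = q' := by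
  obtain ⟨h1, h2, rfl, h4⟩ := h
  obtain ⟨h1', h2', rfl, h4'⟩ := h'
  have : p'' = p' := by
    rcases Nat.lt_trichotomy p'' p' with h5 | h5 | h5
    · have := h2' p' h5
      have := hW p' le_rfl
      omega
    · exact h5
    · have := h2 p'' h5
      have := hW p'' h5.le
      omega
  omega

theorem sep {W S p2 q2 S2 p2' q2' j} (hr : RowStep W S p2 q2 S2 p2' q2') (hj : ¬ S j)
    (hW : 0 < W j) (hlt : q2' < j) : q2 < j := by
  rcases hr with ⟨hnb, hS, rfl, rfl⟩ | ⟨hb, hle, h1, h2, rfl, hS⟩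
  · revert hlt; unfold sh; split_ifs <;> omega
  · have : p2 < j := by
      by_contra hc
      have := h2 j (by omega) (by omega)
      omega
    have : q2 ≠ j := by rintro rfl; exact hj hb.2.1
    have := hb.2.2
    omega

theorem step_S_ge {W S p q S' p' q' m} (hr : RowStep W S p q S' p' q') (h : q < m) (hlt : p < q) :
    S' m ↔ S m := by
  rcases hr with ⟨hnb, hS, rfl, rfl⟩ | ⟨hb, hle, h1, h2, rfl, hS⟩
  · exact hS m
  · rw [hS]; constructor
    · rintro (h | h); exact h.1; omega
    · intro h; left; exact ⟨h, by omega⟩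

theorem com_create {S u W o S2 u2 W2 o2 S3 W3 o3 S23 S32 p2 q2 p2' q2' p3' q3' p2'' q2'' p3'' q3''}
    (hg : GoodRow S u W) (h : Row S u W o) (h2 : Row S2 u2 W2 o2) (h3 : Row S3 u W3 o3)
    (h02 : W2 0 = W 0) (h03 : W3 0 = W 0)
    (hs2 : SwapRel u u2 p2 q2) (hr2 : RowStep W S p2 q2 S2 p2' q2')
    (hc3 : Create W S S3 p3' q3') (hlt : q2' < p3')
    (hc23 : Create W2 S2 S23 p3'' q3'') (hr32 : RowStep W3 S3 p2 q2 S32 p2'' q2'') :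
    (p3'' = p3' ∧ q3'' = q3') ∧ (p2'' = p2' ∧ q2'' = q2') ∧ ∀ m, S23 m ↔ S32 m := by
  have ho := hc3.open_space h
  have hsep := sep hr2 ho.1 hc3.1 hlt
  have k2 := row_step hg h h2 h02 hs2 hr2
  have k3 := row_create hg h h3 h03 hc3
  have hpq := hs2.lt
  have hS3 := hc3.2.2.2
  have hp3 : ∀ m, m < p3' → (S3 m ↔ S m) := fun m hm => by
    rw [hS3]; constructor
    · rintro (h | h); exact h; omega
    · exact Or.inl
  have e3 := det_create hc3 hc23 (fun m hm => k2.2.2.2 m (by omega) (by omega))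
  have e2 := det_step hr2 hr32 (hp3 _ (by omega)) (hp3 _ (by omega))
    (fun _ m _ hm => k3.2.2.1 m (by omega))
  refine ⟨e3, e2, ?_⟩
  have hS23 := hc23.2.2.2
  intro m
  rw [hS23, e3.1]
  have hB : Bump S3 p2 q2 ↔ Bump S p2 q2 := by
    unfold Bump; rw [hp3 _ (by omega), hp3 _ (by omega)]
  rcases hr2 with ⟨hnb, hS, rfl, rfl⟩ | ⟨hb, hle, h1, h2, rfl, hS⟩ <;>
  rcases hr32 with ⟨hnb', hS', rfl, rfl⟩ | ⟨hb', hle', h1', h2', rfl, hS'⟩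
  · rw [hS', hS3, hS]
  · tauto
  · tauto
  · rw [hS', hS3, hS, e2.1]
    by_cases hm : m = p3'
    · have : m ≠ q2 := by omega
      tauto
    · tauto

theorem com_step {S u W o S2 u2 W2 o2 S3 u3 W3 o3 S23 S32 p2 q2 p2' q2' p3 q3 p3' q3' p2'' q2'' p3'' q3''}
    (hg : GoodRow S u W) (h : Row S u W o) (h2 : Row S2 u2 W2 o2) (h3 : Row S3 u3 W3 o3)
    (h02 : W2 0 = W 0) (h03 : W3 0 = W 0)
    (hs2 : SwapRel u u2 p2 q2) (hr2 : RowStep W S p2 q2 S2 p2' q2')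
    (hs3 : SwapRel u u3 p3 q3) (hr3 : RowStep W S p3 q3 S3 p3' q3')
    (hlt : q2 < p3) (hlt' : q2' < p3')
    (hr23 : RowStep W2 S2 p3 q3 S23 p3'' q3'') (hr32 : RowStep W3 S3 p2 q2 S32 p2'' q2'') :
    (p3'' = p3' ∧ q3'' = q3') ∧ (p2'' = p2' ∧ q2'' = q2') ∧ ∀ m, S23 m ↔ S32 m := by
  have k2 := row_step hg h h2 h02 hs2 hr2
  have k3 := row_step hg h h3 h03 hs3 hr3
  have hpq2 := hs2.lt
  have hpq3 := hs3.lt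
  have hsep : Bump S p3 q3 → q2 < p3' := by
    intro hb
    rcases hr3 with ⟨hnb, hS, rfl, rfl⟩ | ⟨hb, hle, h1, h2, rfl, hS⟩
    · tauto
    · exact sep hr2 (bump_open h hs3 hb hle h1 h2).1 h1 hlt'
  have hp3 : ∀ m, m ≤ q2 → (S3 m ↔ S m) := fun m hm => by
    rcases hr3 with ⟨hnb, hS, rfl, rfl⟩ | ⟨hb, hle, h1, h2, rfl, hS⟩
    · exact hS m
    · have := hsep hb
      rw [hS]; constructor
      · rintro (h | h); exact h.1; omega
      · intro h; exact Or.inl ⟨h, by omega⟩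
  have e3 := det_step hr3 hr23 (step_S_ge hr2 (by omega) hpq2) (step_S_ge hr2 (by omega) hpq2)
    (fun hb m hm _ => k2.2.2.2 m (by have := hsep hb; omega) (by omega))
  have hge : ∀ m ≤ p2, W3 m = W m := by
    intro m hm
    rcases hr3 with ⟨hnb, hS, rfl, rfl⟩ | ⟨hb, hle, h1, h2, rfl, hS⟩
    · exact k3.2.2.1 m (by omega) (by unfold sh; split_ifs <;> omega)
    · exact k3.2.2.1 m (by omega) (by have := hsep hb; omega)
  have e2 := det_step hr2 hr32 (hp3 _ (by omega)) (hp3 _ (by omega))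
    (fun _ m _ hm => hge m hm)
  refine ⟨e3, e2, ?_⟩
  intro m
  have hB2 : Bump S3 p2 q2 ↔ Bump S p2 q2 := by
    unfold Bump; rw [hp3 _ (by omega), hp3 _ (by omega)]
  have hB3 : Bump S2 p3 q3 ↔ Bump S p3 q3 := by
    unfold Bump
    rw [step_S_ge hr2 (by omega) hpq2, step_S_ge hr2 (by omega) hpq2]
  rcases hr3 with ⟨hnb3, hS3, rfl, rfl⟩ | ⟨hb3, hle3, h13, h23, rfl, hS3⟩ <;>
  rcases hr23 with ⟨hnb3', hS3', rfl, rfl⟩ | ⟨hb3', hle3', h13', h23', rfl, hS3'⟩ <;>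
  rcases hr2 with ⟨hnb, hS, rfl, rfl⟩ | ⟨hb, hle, h1, h2, rfl, hS⟩ <;>
  rcases hr32 with ⟨hnb', hS', rfl, rfl⟩ | ⟨hb', hle', h1', h2', rfl, hS'⟩ <;>
  try (exfalso; first | exact hnb3' (hB3.2 hb3) | exact hnb3 (hB3.1 hb3') | exact hnb' (hB2.2 hb) | exact hnb (hB2.1 hb'))
  · rw [hS3', hS', hS, hS3]
  · rw [hS3', hS', hS, hS3, e2.1]
  · rw [hS3', hS', hS, hS3, e3.1]
  · rw [hS3', hS', hS, hS3, e3.1, e2.1]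
    have := hsep hb3
    by_cases hm : m = p3'
    · have : m ≠ q2 := by omega
      tauto
    · by_cases hm' : m = p2'
      · have : m ≠ q3 := by omega
        tauto
      · tauto



def XX (n : ℕ) (R : Finset (ℤ × ℤ)) (r m : ℕ) : Prop := ((n : ℤ) - m, (r : ℤ)) ∈ R
def UU (n : ℕ) (R : Finset (ℤ × ℤ)) (r m : ℕ) : ℤ := lab n R false ((n : ℤ) - m) r
def WW (n : ℕ) (R : Finset (ℤ × ℤ)) (r m : ℕ) : ℤ := lab n R true ((n : ℤ) - m) r

def Box (n : ℕ) (R : Finset (ℤ × ℤ)) : Prop := ∀ p ∈ R, p.1 ≤ n ∧ 1 ≤ p.2 ∧ p.2 ≤ n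

def Good (n : ℕ) (R : Finset (ℤ × ℤ)) : Prop :=
  Box n R ∧ ∀ r, GoodRow (XX n R r) (UU n R r) (WW n R r)

theorem WW_zero (n R r) : WW n R r 0 = r := by
  unfold WW; rw [lab]; simp

theorem lab_true_start (n : ℤ) (R i k) (h : n ≤ i) : lab n R true i k = k := by
  rw [lab, dif_pos h]

theorem lab_true_mem (n : ℤ) (R i k) (h : i < n) (hm : (i + 1, k) ∈ R) :
    lab n R true i k = lab n R true (i + 1) k := by
  conv_lhs => rw [lab]
  rw [dif_neg (by omega), if_pos hm]

theorem lab_true_not (n : ℤ) (R i k) (h : i < n) (hm : (i + 1, k) ∉ R) :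
    lab n R true i k = lab n R false (i + 1) k := by
  conv_lhs => rw [lab]
  rw [dif_neg (by omega), if_neg hm]

theorem lab_false_start (n : ℤ) (R i k) (h : k ≤ 0) : lab n R false i k = i + k - n - 1 := by
  rw [lab, dif_pos h]

theorem lab_false_mem (n : ℤ) (R i k) (h : 0 < k) (hm : (i, k - 1) ∈ R) :
    lab n R false i k = lab n R false i (k - 1) := by
  conv_lhs => rw [lab]
  rw [dif_neg (by omega), if_pos hm]

theorem lab_false_not (n : ℤ) (R i k) (h : 0 < k) (hm : (i, k - 1) ∉ R) :
    lab n R false i k = lab n R true i (k - 1) := by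
  conv_lhs => rw [lab]
  rw [dif_neg (by omega), if_neg hm]

theorem row_of (n R) (r : ℕ) : Row (XX n R r) (UU n R r) (WW n R r) (UU n R (r + 1)) := by
  constructor
  · intro m
    unfold WW UU XX
    have h1 : (n : ℤ) - ((m + 1 : ℕ) : ℤ) < n := by push_cast; omega
    have h2 : (n : ℤ) - ((m + 1 : ℕ) : ℤ) + 1 = n - m := by push_cast; ring
    split_ifs with h
    · rw [lab_true_mem _ _ _ _ h1 (by rw [h2]; exact h), h2]
    · rw [lab_true_not _ _ _ _ h1 (by rw [h2]; exact h), h2]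
  · intro m
    unfold WW UU XX
    have h1 : 0 < ((r + 1 : ℕ) : ℤ) := by push_cast; omega
    have h2 : ((r + 1 : ℕ) : ℤ) - 1 = r := by push_cast; ring
    split_ifs with h
    · rw [lab_false_mem _ _ _ _ h1 (by rw [h2]; exact h), h2]
    · rw [lab_false_not _ _ _ _ h1 (by rw [h2]; exact h), h2]

theorem UU_one {n R} (hB : Box n R) (m : ℕ) : UU n R 1 m = - m := by
  unfold UU
  rw [lab]
  have h3 : ∀ i : ℤ, (i, (0 : ℤ)) ∉ R := fun i hi => by have := (hB _ hi).2.1; simp at this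
  rw [dif_neg (by simp)]
  simp only [Nat.cast_one, sub_self]
  rw [if_neg (h3 _), lab]
  by_cases hm : (n : ℤ) ≤ n - m
  · rw [dif_pos hm]; omega
  · rw [dif_neg hm, if_neg (h3 _), lab, dif_pos (by simp)]; ring

theorem XX_zero {n R} (hB : Box n R) (m : ℕ) : ¬ XX n R 0 m := by
  intro h; have := (hB _ h).2.1; simp at this

theorem XX_big {n R} (hB : Box n R) {r : ℕ} (hr : n < r) (m : ℕ) : ¬ XX n R r m := by
  intro h; have := (hB _ h).2.2; simp at this; omega

theorem ext_XX {n R R'} (hB : Box n R) (hB' : Box n R') (h : ∀ r ≤ n, ∀ m, XX n R r m ↔ XX n R' r m) :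
    R = R' := by
  ext ⟨i, k⟩
  by_cases hk : 0 ≤ k ∧ k ≤ n ∧ i ≤ n
  · have := h k.toNat (by omega) ((n : ℤ) - i).toNat
    unfold XX at this
    have e1 : (n : ℤ) - (((n : ℤ) - i).toNat : ℤ) = i := by omega
    have e2 : ((k.toNat : ℕ) : ℤ) = k := by omega
    rw [e1, e2] at this
    exact this
  · constructor
    · intro h; have := hB _ h; simp at this; omega
    · intro h; have := hB' _ h; simp at this; omega

/-- If rows below `k` agree then the labels entering row `k` agree. -/
theorem UU_congr {n R R'} (hB : Box n R) (hB' : Box n R') (k : ℕ)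
    (h : ∀ r < k, ∀ m, XX n R' r m ↔ XX n R r m) :
    ∀ r, 1 ≤ r → r ≤ k → ∀ m, UU n R' r m = UU n R r m := by
  intro r hr
  induction r, hr using Nat.le_induction with
  | base => intro _ m; rw [UU_one hB, UU_one hB']
  | succ r hr ih =>
    intro hk m
    exact ((row_of n R r).prefix_eq (row_of n R' r) (by rw [WW_zero, WW_zero]) (m + 1)
      (fun m _ => h r (by omega) m) (fun m _ => ih (by omega) m)).2 m (by omega)

theorem WW_congr {n R R'} (r : ℕ) (hr : 1 ≤ r) (h : ∀ m, XX n R' r m ↔ XX n R r m)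
    (hu : ∀ m, UU n R' r m = UU n R r m) (m : ℕ) : WW n R' r m = WW n R r m :=
  ((row_of n R r).prefix_eq (row_of n R' r) (by rw [WW_zero, WW_zero]) m
      (fun m _ => h m) (fun m _ => hu m)).1 m le_rfl

/-- Specification of the result of an insertion. -/
structure Spec (n : ℕ) (R : Finset (ℤ × ℤ)) (k : ℕ) (R' : Finset (ℤ × ℤ)) (P Q : ℕ → ℕ) : Prop where
  box : Box n R'
  below : ∀ r < k, ∀ m, XX n R' r m ↔ XX n R r m
  create : Create (WW n R k) (XX n R k) (XX n R' k) (P k) (Q k)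
  step : ∀ r, k ≤ r → r + 1 ≤ n →
    RowStep (WW n R (r + 1)) (XX n R (r + 1)) (P r) (Q r) (XX n R' (r + 1)) (P (r + 1)) (Q (r + 1))

theorem Spec.uu {n R k R' P Q} (hB : Box n R) (h : Spec n R k R' P Q) :
    ∀ r, 1 ≤ r → r ≤ k → UU n R' r = UU n R r :=
  fun r h1 h2 => funext fun m => UU_congr hB h.box k h.below r h1 h2 m

theorem Spec.swap {n R k R' P Q} (hG : Good n R) (hk : 1 ≤ k) (h : Spec n R k R' P Q) :
    ∀ r, k ≤ r → r ≤ n → SwapRel (UU n R (r + 1)) (UU n R' (r + 1)) (P r) (Q r) := by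
  intro r hr
  induction r, hr using Nat.le_induction with
  | base =>
    intro hn
    have hR' := row_of n R' k
    rw [h.uu hG.1 k hk le_rfl] at hR'
    exact (row_create (hG.2 k) (row_of n R k) hR' (by rw [WW_zero, WW_zero]) h.create).1
  | succ r hr ih =>
    intro hn
    exact (row_step (hG.2 (r + 1)) (row_of n R (r + 1)) (row_of n R' (r + 1))
      (by rw [WW_zero, WW_zero]) (ih (by omega)) (h.step r hr hn)).1

theorem Spec.good {n R k R' P Q} (hG : Good n R) (hk : 1 ≤ k) (h : Spec n R k R' P Q) :
    Good n R' := by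
  refine ⟨h.box, ?_⟩
  intro r
  rcases Nat.eq_zero_or_pos r with rfl | hr
  · intro m hm; exact absurd hm (XX_zero h.box m)
  rcases Nat.lt_or_ge n r with hn | hn
  · intro m hm; exact absurd hm (XX_big h.box hn m)
  rcases Nat.lt_trichotomy r k with h1 | rfl | h1
  · have hu := h.uu hG.1 r hr h1.le
    have hx := h.below r h1
    intro m hm
    rw [WW_congr r hr hx (fun m => congrFun hu m), hu]
    exact hG.2 r m ((hx m).1 hm)
  · have hR' := row_of n R' r
    rw [h.uu hG.1 r hk le_rfl] at hR'
    rw [h.uu hG.1 r hk le_rfl]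
    exact (row_create (hG.2 r) (row_of n R r) hR' (by rw [WW_zero, WW_zero]) h.create).2.1
  · obtain ⟨r, rfl⟩ : ∃ s, r = s + 1 := ⟨r - 1, by omega⟩
    exact (row_step (hG.2 (r + 1)) (row_of n R (r + 1)) (row_of n R' (r + 1))
      (by rw [WW_zero, WW_zero]) (h.swap hG hk r (by omega) (by omega)) (h.step r (by omega) hn)).2.1

theorem claim1 {n R x y R1 R12 P1 Q1 P2 Q2} (hG : Good n R) (hx : 1 ≤ x) (hxy : x < y)
    (h1 : Spec n R y R1 P1 Q1) (h2 : Spec n R1 x R12 P2 Q2) :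
    ∀ r, y ≤ r → r ≤ n → Q2 r ≤ P1 r := by
  have hG1 := h1.good hG (by omega)
  intro r hr
  induction r, hr using Nat.le_induction with
  | base =>
    intro hn
    obtain ⟨s, rfl⟩ : ∃ s, y = s + 1 := ⟨y - 1, by omega⟩
    have hs2 := h2.swap hG1 hx s (by omega) (by omega)
    rw [h1.uu hG.1 (s + 1) (by omega) le_rfl] at hs2
    exact c1_create (row_of n R (s + 1)) h1.create hs2 (h2.step s (by omega) hn)
      (hG.2 _)
  | succ r hr ih =>
    intro hn
    exact c1_step (row_of n R (r + 1)) (h1.swap hG (by omega) r hr (by omega))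
      (h1.step r hr hn) (h2.swap hG1 hx r (by omega) (by omega)) (h2.step r (by omega) hn)
      (ih (by omega)) (hG.2 _)

theorem claim2 {n R y z R1 R13 P1 Q1 P3 Q3} (hG : Good n R) (hy : 1 ≤ y) (hyz : y ≤ z)
    (h1 : Spec n R y R1 P1 Q1) (h3 : Spec n R1 z R13 P3 Q3) :
    ∀ r, z ≤ r → r ≤ n → Q1 r ≤ P3 r := by
  have hG1 := h1.good hG (by omega)
  intro r hr
  induction r, hr using Nat.le_induction with
  | base =>
    intro hn
    exact c2_create (row_of n R1 z) (hG1.2 _) (h1.swap hG hy z hyz hn) h3.create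
  | succ r hr ih =>
    intro hn
    exact c2_step (row_of n R (r + 1)) (hG.2 _) (row_of n R1 (r + 1))
      (hG1.2 _) (h1.swap hG (by omega) r (by omega) (by omega))
      (h1.step r (by omega) hn) (h1.swap hG (by omega) (r + 1) (by omega) (by omega))
      (h3.step r (by omega) hn) (ih (by omega))

theorem commute {n R x z R2 R23 R3 R32 P2 Q2 P3 Q3 P2' Q2' P3' Q3'} (hG : Good n R) (hx : 1 ≤ x)
    (hxz : x < z) (hzn : z ≤ n)
    (h2 : Spec n R x R2 P2 Q2) (h23 : Spec n R2 z R23 P3' Q3')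
    (h3 : Spec n R z R3 P3 Q3) (h32 : Spec n R3 x R32 P2' Q2')
    (hsep : ∀ r, z ≤ r → r ≤ n → Q2 r < P3 r) : R23 = R32 := by
  have hG2 := h2.good hG hx
  have hG3 := h3.good hG (by omega)
  -- rows below z
  have hW3 : ∀ r, 1 ≤ r → r < z → ∀ m, WW n R3 r m = WW n R r m := fun r hr hz m =>
    WW_congr r hr (h3.below r hz) (fun m => congrFun (h3.uu hG.1 r hr hz.le) m) m
  have A : ∀ r, x ≤ r → r < z → P2' r = P2 r ∧ Q2' r = Q2 r := by
    intro r hr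
    induction r, hr using Nat.le_induction with
    | base =>
      intro hz
      exact det_create h2.create h32.create (fun m _ => hW3 x hx hz m)
    | succ r hr ih =>
      intro hz
      have e := ih (by omega)
      have s32 := h32.step r hr (by omega)
      rw [e.1, e.2] at s32
      exact det_step (h2.step r hr (by omega)) s32 (h3.below _ hz _) (h3.below _ hz _)
        (fun _ m _ _ => hW3 _ (by omega) hz m)
  have AX : ∀ r, r < z → ∀ m, XX n R23 r m ↔ XX n R32 r m := by
    intro r hz m
    rw [h23.below r hz]
    rcases Nat.lt_trichotomy r x with h | rfl | h
    · rw [h2.below r h, h32.below r h, h3.below r hz]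
    · rw [h2.create.2.2.2, h32.create.2.2.2, h3.below r hz, (A r le_rfl hz).1]
    · obtain ⟨r, rfl⟩ : ∃ s, r = s + 1 := ⟨r - 1, by omega⟩
      have e := A r (by omega) (by omega)
      have e' := A (r + 1) (by omega) hz
      have s2 := h2.step r (by omega) (by omega)
      have s32 := h32.step r (by omega) (by omega)
      rw [e.1, e.2, e'.1] at s32
      have hB : Bump (XX n R3 (r + 1)) (P2 r) (Q2 r) ↔ Bump (XX n R (r + 1)) (P2 r) (Q2 r) := by
        unfold Bump; rw [h3.below _ hz, h3.below _ hz]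
      rcases s2 with ⟨hnb, hS, -, -⟩ | ⟨hb, -, -, -, -, hS⟩ <;>
      rcases s32 with ⟨hnb', hS', -, -⟩ | ⟨hb', -, -, -, -, hS'⟩
      · rw [hS, hS', h3.below _ hz]
      · exact absurd (hB.1 hb') hnb
      · exact absurd (hB.2 hb) hnb'
      · rw [hS, hS', h3.below _ hz]
  have B : ∀ r, z ≤ r → r ≤ n → (P3' r = P3 r ∧ Q3' r = Q3 r) ∧ (P2' r = P2 r ∧ Q2' r = Q2 r) ∧
      ∀ m, XX n R23 r m ↔ XX n R32 r m := by
    intro r hr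
    induction r, hr using Nat.le_induction with
    | base =>
      intro _
      obtain ⟨s, rfl⟩ : ∃ s, z = s + 1 := ⟨z - 1, by omega⟩
      have e := A s (by omega) (by omega)
      have s32 := h32.step s (by omega) hzn
      rw [e.1, e.2] at s32
      have rR3 := row_of n R3 (s + 1)
      rw [h3.uu hG.1 (s + 1) (by omega) le_rfl] at rR3
      exact com_create (hG.2 _) (row_of n R (s + 1)) (row_of n R2 (s + 1))
        rR3 (by simp only [WW_zero]) (by simp only [WW_zero])
        (h2.swap hG hx s (by omega) (by omega)) (h2.step s (by omega) hzn)
        h3.create (hsep _ le_rfl hzn) h23.create s32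
    | succ r hr ih =>
      intro hn
      obtain ⟨e3, e2, -⟩ := ih (by omega)
      have s32 := h32.step r (by omega) hn
      have s23 := h23.step r (by omega) hn
      rw [e2.1, e2.2] at s32
      rw [e3.1, e3.2] at s23
      exact com_step (hG.2 _) (row_of n R (r + 1)) (row_of n R2 (r + 1))
        (row_of n R3 (r + 1)) (by simp only [WW_zero]) (by simp only [WW_zero])
        (h2.swap hG hx r (by omega) (by omega)) (h2.step r (by omega) hn)
        (h3.swap hG (by omega) r (by omega) (by omega)) (h3.step r (by omega) hn)
        (hsep _ hr (by omega)) (hsep _ (by omega) hn) s23 s32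
  refine ext_XX h23.box h32.box (fun r hr m => ?_)
  rcases Nat.lt_or_ge r z with h | h
  · exact AX r h m
  · exact (B r h hr).2.2 m

theorem main_of_spec {n : ℕ} (hins : ∀ R k, Good n R → 1 ≤ k → k ≤ n →
      ∃ P Q, Spec n R k (insertOne n R k) P Q) (R) (hG : Good n R) (x y z : ℕ)
    (hx : 0 < x) (hxy : x < y) (hyz : y ≤ z) (hzn : z ≤ n) :
    insertWord n R [y, x, z] = insertWord n R [y, z, x] := by
  simp only [insertWord]
  obtain ⟨P1, Q1, h1⟩ := hins R y hG (by omega) (by omega)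
  have hG1 := h1.good hG (by omega)
  obtain ⟨P2, Q2, h2⟩ := hins _ x hG1 (by omega) (by omega)
  obtain ⟨P3, Q3, h3⟩ := hins _ z hG1 (by omega) (by omega)
  have hG2 := h2.good hG1 (by omega)
  have hG3 := h3.good hG1 (by omega)
  obtain ⟨P23, Q23, h23⟩ := hins _ z hG2 (by omega) (by omega)
  obtain ⟨P32, Q32, h32⟩ := hins _ x hG3 (by omega) (by omega)
  refine commute hG1 hx (by omega) hzn h2 h23 h3 h32 (fun r hr hn => ?_)
  have c1 := claim1 hG hx hxy h1 h2 r (by omega) hn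
  have c2 := claim2 hG (by omega) hyz h1 h3 r hr hn
  have := (h1.swap hG (by omega) r (by omega) hn).lt
  omega



def pw (l : List ℤ) : Equiv.Perm ℤ := (l.map sT).prod

theorem pw_nil : pw [] = 1 := rfl
theorem pw_cons (j l) : pw (j :: l) = sT j * pw l := by simp [pw]
theorem pw_append (l l') : pw (l ++ l') = pw l * pw l' := by simp [pw]

theorem sT_apply (j t : ℤ) : sT j t = if t = j then j + 1 else if t = j + 1 then j else t := by
  unfold sT; rw [Equiv.swap_apply_def]

theorem sT_inv (j : ℤ) : (sT j)⁻¹ = sT j := by unfold sT; exact Equiv.swap_inv _ _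

def Inv (w : Equiv.Perm ℤ) : Set (ℤ × ℤ) := {ab | ab.1 < ab.2 ∧ w ab.2 < w ab.1}

theorem Inv_sub (j w) : Inv (sT j * w) ⊆ insert (w⁻¹ j, w⁻¹ (j + 1)) (Inv w) := by
  rintro ⟨a, b⟩ ⟨h1, h2⟩
  simp only [Equiv.Perm.mul_apply, sT_apply] at h1 h2
  by_cases h : w b < w a
  · right; exact ⟨h1, h⟩
  · left
    have hne : w a ≠ w b := fun he => by have := w.injective he; omega
    have : w a = j ∧ w b = j + 1 := by split_ifs at h2 <;> omega
    rw [← this.2, ← this.1]; simp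

theorem Inv_up (j w) (h : w⁻¹ j < w⁻¹ (j + 1)) :
    Inv (sT j * w) = insert (w⁻¹ j, w⁻¹ (j + 1)) (Inv w) ∧ (w⁻¹ j, w⁻¹ (j + 1)) ∉ Inv w := by
  refine ⟨Set.Subset.antisymm (Inv_sub j w) ?_, ?_⟩
  · rintro ⟨a, b⟩ (h' | ⟨h1, h2⟩)
    · rw [h']
      refine ⟨h, ?_⟩
      simp [Equiv.Perm.mul_apply, sT_apply]
    · simp only at h1 h2
      refine ⟨h1, ?_⟩
      simp only [Equiv.Perm.mul_apply, sT_apply]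
      by_cases hc : w b = j ∧ w a = j + 1
      · exfalso
        rw [← hc.2, ← hc.1] at h
        simp at h
        omega
      · split_ifs <;> omega
  · rintro ⟨_, h2⟩
    simp at h2

theorem Inv_card (l) : (Inv (pw l)).Finite ∧ (Inv (pw l)).ncard ≤ l.length := by
  induction l with
  | nil =>
    have : Inv (pw []) = ∅ := by
      ext ⟨a, b⟩; simp [Inv, pw_nil]; intro h; omega
    rw [this]; simp
  | cons j l ih =>
    rw [pw_cons]
    refine ⟨(ih.1.insert _).subset (Inv_sub j _), ?_⟩
    refine (Set.ncard_le_ncard (Inv_sub j _) (ih.1.insert _)).trans ?_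
    refine (Set.ncard_insert_le _ _).trans ?_
    simp; exact ih.2

def LGood : List ℤ → Prop
  | [] => True
  | j :: l => LGood l ∧ (pw l)⁻¹ j < (pw l)⁻¹ (j + 1)

theorem LGood.card {l} (h : LGood l) : (Inv (pw l)).ncard = l.length := by
  induction l with
  | nil =>
    have : Inv (pw []) = ∅ := by
      ext ⟨a, b⟩; simp [Inv, pw_nil]; intro h; omega
    rw [this]; simp
  | cons j l ih =>
    rw [pw_cons, (Inv_up j _ h.2).1, Set.ncard_insert_of_notMem (Inv_up j _ h.2).2 (Inv_card l).1,
      ih h.1]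
    simp

theorem len_le (l) : len (pw l) ≤ l.length := Nat.sInf_le ⟨l, rfl, rfl⟩

theorem len_ge (l) : (Inv (pw l)).ncard ≤ len (pw l) := by
  have : {m : ℕ | ∃ l' : List ℤ, l'.length = m ∧ (l'.map sT).prod = pw l}.Nonempty := ⟨_, l, rfl, rfl⟩
  obtain ⟨l', h1, h2⟩ := Nat.sInf_mem this
  unfold len
  rw [← h1]
  change pw l' = pw l at h2
  rw [← h2]
  exact (Inv_card l').2

theorem LGood.len {l} (h : LGood l) : len (pw l) = l.length :=
  le_antisymm (len_le l) (by rw [← h.card]; exact len_ge l)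

theorem exch (l : List ℤ) : ∀ a b : ℤ, a < b → (pw l)⁻¹ b < (pw l)⁻¹ a →
    ∃ l' : List ℤ, l'.length + 1 = l.length ∧ pw l' = Equiv.swap a b * pw l := by
  induction l with
  | nil => intro a b h1 h2; simp [pw_nil] at h2; omega
  | cons j t ih =>
    intro a b hab h
    rw [pw_cons, mul_inv_rev, sT_inv] at h
    simp only [Equiv.Perm.mul_apply] at h
    by_cases hc : a = j ∧ b = j + 1
    · refine ⟨t, by simp, ?_⟩
      rw [pw_cons, hc.1, hc.2, ← mul_assoc]
      simp [sT]
    · have hlt : sT j a < sT j b := by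
        simp only [sT_apply]; split_ifs <;> omega
      obtain ⟨t', h1, h2⟩ := ih _ _ hlt h
      refine ⟨j :: t', by simp [h1], ?_⟩
      rw [pw_cons, pw_cons, h2, ← mul_assoc, ← mul_assoc, Equiv.mul_swap_eq_swap_mul]
      congr 2
      have : ∀ c, sT j (sT j c) = c := fun c => by unfold sT; simp
      rw [this, this]

theorem len_lt {l} (h : ¬ LGood l) : len (pw l) < l.length := by
  induction l with
  | nil => exact absurd trivial h
  | cons j t ih =>
    by_cases ht : LGood t
    · have h' : (pw t)⁻¹ (j + 1) < (pw t)⁻¹ j := by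
        by_contra hc
        apply h
        refine ⟨ht, lt_of_le_of_ne (not_lt.1 hc) ?_⟩
        intro he; have := (pw t)⁻¹.injective he; omega
      obtain ⟨l', h1, h2⟩ := exch t j (j + 1) (by omega) h'
      have : pw l' = pw (j :: t) := by rw [h2, pw_cons]; rfl
      rw [← this]
      have := len_le l'
      simp; omega
    · have h1 := ih ht
      have hne : {m : ℕ | ∃ l' : List ℤ, l'.length = m ∧ (l'.map sT).prod = pw t}.Nonempty := ⟨_, t, rfl, rfl⟩
      obtain ⟨l', h2, h3⟩ := Nat.sInf_mem hne
      change l'.length = len (pw t) at h2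
      change pw l' = pw t at h3
      have : pw (j :: l') = pw (j :: t) := by rw [pw_cons, pw_cons, h3]
      rw [← this]
      have := len_le (j :: l')
      simp at this ⊢
      omega

theorem LGood_iff (l) : LGood l ↔ len (pw l) = l.length :=
  ⟨LGood.len, fun h => by by_contra hc; have := len_lt hc; omega⟩



/-- The index of the simple transposition attached to a position. -/
def letter (n : ℤ) (p : ℤ × ℤ) : ℤ := p.1 + p.2 - n - 1

def ww (n : ℤ) (F : Finset (ℤ × ℤ)) : List ℤ := (F.sort rcOrder).map (letter n)

theorem wR_eq (n F) : wR n F = pw (ww n F) := by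
  unfold wR pw ww; rw [List.map_map]; rfl

theorem ww_of_list (n : ℤ) (l : List (ℤ × ℤ)) (hn : l.Nodup) (hp : l.Pairwise rcOrder) :
    ww n l.toFinset = l.map (letter n) := by
  unfold ww
  rw [(List.toFinset_sort (r := rcOrder) hn).2 hp]

theorem ww_union (n : ℤ) (A B : Finset (ℤ × ℤ)) (h : ∀ a ∈ A, ∀ b ∈ B, rcOrder a b ∧ a ≠ b) :
    ww n (A ∪ B) = ww n A ++ ww n B := by
  have h1 : A ∪ B = (A.sort rcOrder ++ B.sort rcOrder).toFinset := by
    rw [List.toFinset_append, Finset.sort_toFinset, Finset.sort_toFinset]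
  rw [h1, ww_of_list]
  · simp [ww]
  · rw [List.nodup_append]
    refine ⟨Finset.sort_nodup _ _, Finset.sort_nodup _ _, ?_⟩
    intro a ha b hb
    exact (h a (by simpa using ha) b (by simpa using hb)).2
  · rw [List.pairwise_append]
    refine ⟨Finset.pairwise_sort _ _, Finset.pairwise_sort _ _, ?_⟩
    intro a ha b hb
    exact (h a (by simpa using ha) b (by simpa using hb)).1

theorem ww_single (n : ℤ) (p) : ww n {p} = [letter n p] := by simp [ww]

theorem mem_ww (n F j) : j ∈ ww n F ↔ ∃ p ∈ F, letter n p = j := by simp [ww]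

theorem pw_fix (l : List ℤ) (t : ℤ) (h : ∀ j ∈ l, j ≠ t ∧ j + 1 ≠ t) : (pw l)⁻¹ t = t := by
  rw [Equiv.Perm.inv_eq_iff_eq]
  induction l with
  | nil => rfl
  | cons j l ih =>
    rw [pw_cons, Equiv.Perm.mul_apply, ← ih (fun j hj => h j (by simp [hj])), sT_apply]
    have := h j (by simp)
    rw [if_neg (by omega), if_neg (by omega)]

def Aft (R : Finset (ℤ × ℤ)) (i k : ℤ) : Finset (ℤ × ℤ) :=
  R.filter fun q => q.2 < k ∨ (q.2 = k ∧ i < q.1)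

theorem mem_Aft (R i k q) : q ∈ Aft R i k ↔ q ∈ R ∧ (q.2 < k ∨ (q.2 = k ∧ i < q.1)) := by
  simp [Aft]

theorem pw_app_inv (l l' : List ℤ) (t) : (pw (l ++ l'))⁻¹ t = (pw l')⁻¹ ((pw l)⁻¹ t) := by
  rw [pw_append, mul_inv_rev, Equiv.Perm.mul_apply]

theorem pw_cons_inv (j : ℤ) (l' : List ℤ) (t) : (pw (j :: l'))⁻¹ t = (pw l')⁻¹ (sT j t) := by
  rw [pw_cons, mul_inv_rev, Equiv.Perm.mul_apply, sT_inv]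

theorem ww_cons (n : ℤ) (F p) (h : ∀ b ∈ F, rcOrder p b ∧ p ≠ b) :
    ww n (insert p F) = letter n p :: ww n F := by
  rw [Finset.insert_eq, ww_union, ww_single]; rfl
  intro a ha b hb
  rw [Finset.mem_singleton] at ha
  subst ha; exact h b hb

theorem ww_Aft_row (n : ℤ) (R i k) :
    ww n (Aft R i k) = if (i + 1, k) ∈ R then letter n (i + 1, k) :: ww n (Aft R (i + 1) k)
      else ww n (Aft R (i + 1) k) := by
  split_ifs with h
  · rw [← ww_cons]
    · congr 1
      ext ⟨a, b⟩
      simp only [Finset.mem_insert, mem_Aft, Prod.mk.injEq]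
      constructor
      · rintro ⟨h1, h2⟩
        by_cases h3 : a = i + 1 ∧ b = k
        · exact Or.inl h3
        · exact Or.inr ⟨h1, by omega⟩
      · rintro (⟨rfl, rfl⟩ | ⟨h1, h2⟩)
        · exact ⟨h, by omega⟩
        · exact ⟨h1, by omega⟩
    · rintro ⟨a, b⟩ hb
      simp only [mem_Aft] at hb
      simp only [rcOrder, ne_eq, Prod.mk.injEq]
      omega
  · congr 1
    ext ⟨a, b⟩
    simp only [mem_Aft]
    constructor
    · rintro ⟨h1, h2⟩
      refine ⟨h1, ?_⟩
      by_contra hc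
      have h3 : a = i + 1 ∧ b = k := by omega
      rw [h3.1, h3.2] at h1; exact h h1
    · rintro ⟨h1, h2⟩; exact ⟨h1, by omega⟩

theorem Aft_down (n : ℤ) (R i k) : (pw (ww n (Aft R i k)))⁻¹ (i + k - n - 1) =
    (pw (ww n (Aft R (i - 1) (k - 1))))⁻¹ (i + k - n - 1) := by
  have e : Aft R i k = R.filter (fun q => (q.2 = k ∧ i < q.1) ∨ (q.2 = k - 1 ∧ q.1 < i)) ∪
      Aft R (i - 1) (k - 1) := by
    ext ⟨a, b⟩
    simp only [mem_Aft, Finset.mem_union, Finset.mem_filter]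
    constructor
    · rintro ⟨h1, h2⟩;
      by_cases h3 : (b = k ∧ i < a) ∨ (b = k - 1 ∧ a < i)
      · exact Or.inl ⟨h1, h3⟩
      · exact Or.inr ⟨h1, by omega⟩
    · rintro (⟨h1, h2⟩ | ⟨h1, h2⟩)
      · exact ⟨h1, by omega⟩
      · exact ⟨h1, by omega⟩
  rw [e, ww_union, pw_app_inv]
  · congr 1
    apply pw_fix
    intro j hj
    rw [mem_ww] at hj
    obtain ⟨⟨a, b⟩, hp, rfl⟩ := hj
    simp only [Finset.mem_filter] at hp
    simp only [letter]
    omega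
  · rintro ⟨a, b⟩ hp ⟨c, d⟩ hq
    simp only [Finset.mem_filter] at hp
    simp only [mem_Aft] at hq
    simp only [rcOrder, ne_eq, Prod.mk.injEq]
    omega

theorem lab_eq {n : ℕ} {R} (hB : Box n R) : ∀ (N : ℕ) (i k : ℤ), i ≤ n → ((n : ℤ) - i).toNat + k.toNat < N →
    lab n R false i k = (pw (ww n (Aft R i k)))⁻¹ (i + k - n - 1) ∧
    lab n R true i k = (pw (ww n (Aft R i k)))⁻¹ (i + k - n) := by
  intro N
  induction N with
  | zero => intro i k _ h; omega
  | succ N ih =>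
    intro i k hi hN
    constructor
    · by_cases hk : k ≤ 0
      · rw [lab_false_start _ _ _ _ hk, pw_fix]
        intro j hj
        rw [mem_ww] at hj
        obtain ⟨p, hp, _⟩ := hj
        rw [mem_Aft] at hp
        have := hB p hp.1
        omega
      · rw [Aft_down, ww_Aft_row, sub_add_cancel]
        have := ih i (k - 1) hi (by omega)
        split_ifs with h
        · rw [lab_false_mem _ _ _ _ (by omega) h, this.1, pw_cons_inv, sT_apply]
          congr 1
          have hl : letter n (i, k - 1) = i + k - n - 2 := by unfold letter; ring
          rw [hl, if_neg (by omega), if_pos (by omega)]; ring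
        · rw [lab_false_not _ _ _ _ (by omega) h, this.2]
          congr 1; ring
    · by_cases hin : (n : ℤ) ≤ i
      · rw [lab_true_start _ _ _ _ hin, pw_fix]
        · omega
        · intro j hj
          rw [mem_ww] at hj
          obtain ⟨p, hp, rfl⟩ := hj
          rw [mem_Aft] at hp
          have := hB p hp.1
          simp only [letter]
          omega
      · rw [ww_Aft_row]
        have := ih (i + 1) k (by omega) (by omega)
        split_ifs with h
        · rw [lab_true_mem _ _ _ _ (by omega) h, this.2, pw_cons_inv, sT_apply]
          congr 1
          have hl : letter n (i + 1, k) = i + k - n := by unfold letter; ring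
          rw [hl, if_pos rfl]; ring
        · rw [lab_true_not _ _ _ _ (by omega) h, this.1]
          congr 1; ring

theorem LGood_ww (n : ℤ) (l : List (ℤ × ℤ)) (hn : l.Nodup) (hp : l.Pairwise rcOrder) :
    LGood (l.map (letter n)) ↔ ∀ p ∈ l, (pw (ww n (Aft l.toFinset p.1 p.2)))⁻¹ (letter n p) <
      (pw (ww n (Aft l.toFinset p.1 p.2)))⁻¹ (letter n p + 1) := by
  induction l with
  | nil => simp [LGood]
  | cons p t ih =>
    rw [List.nodup_cons] at hn
    rw [List.pairwise_cons] at hp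
    have e1 : Aft (p :: t).toFinset p.1 p.2 = t.toFinset := by
      ext q
      rw [mem_Aft, List.mem_toFinset, List.mem_toFinset, List.mem_cons]
      constructor
      · rintro ⟨h1 | h1, h2⟩
        · subst h1; omega
        · exact h1
      · intro h1
        refine ⟨Or.inr h1, ?_⟩
        have := hp.1 q h1
        have h3 : ¬ (p.1 = q.1 ∧ p.2 = q.2) := by
          rintro ⟨h4, h5⟩
          exact hn.1 (by rw [Prod.ext h4 h5]; exact h1)
        unfold rcOrder at this
        omega
    have e2 : ∀ q ∈ t, Aft (p :: t).toFinset q.1 q.2 = Aft t.toFinset q.1 q.2 := by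
      intro q hq
      ext s
      rw [mem_Aft, mem_Aft, List.mem_toFinset, List.mem_toFinset, List.mem_cons]
      constructor
      · rintro ⟨h1 | h1, h2⟩
        · subst h1
          have := hp.1 q hq
          unfold rcOrder at this
          omega
        · exact ⟨h1, h2⟩
      · rintro ⟨h1, h2⟩; exact ⟨Or.inr h1, h2⟩
    rw [List.map_cons, LGood, ih hn.2 hp.2]
    simp only [List.mem_cons, forall_eq_or_imp, e1]
    rw [← ww_of_list n t hn.2 hp.2, and_comm]
    refine and_congr_right fun _ => forall₂_congr fun q hq => ?_
    rw [e2 q hq]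

theorem LGood_iff_ww (n : ℤ) (R) : LGood (ww n R) ↔ ∀ p ∈ R, (pw (ww n (Aft R p.1 p.2)))⁻¹ (letter n p) <
      (pw (ww n (Aft R p.1 p.2)))⁻¹ (letter n p + 1) := by
  have := LGood_ww n (R.sort rcOrder) (Finset.sort_nodup _ _) (Finset.pairwise_sort _ _)
  simpa [ww] using this

theorem isRC_iff (n : ℤ) (R) : IsRC n R ↔ (∀ p ∈ R, p.1 ≤ n ∧ p.2 ≤ n) ∧ LGood (ww n R) := by
  unfold IsRC
  rw [LGood_iff, wR_eq]
  simp [ww]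

theorem lab_at {n : ℕ} {R} (hB : Box n R) (p : ℤ × ℤ) (hp : p.1 ≤ n) :
    lab n R false p.1 p.2 = (pw (ww n (Aft R p.1 p.2)))⁻¹ (letter n p) ∧
    lab n R true p.1 p.2 = (pw (ww n (Aft R p.1 p.2)))⁻¹ (letter n p + 1) := by
  have := lab_eq hB _ p.1 p.2 hp (Nat.lt_succ_self _)
  rw [this.1, this.2]
  unfold letter
  refine ⟨rfl, ?_⟩
  congr 1; ring

theorem isRC_box {n : ℕ} {R} (hB : Box n R) :
    IsRC n R ↔ ∀ p ∈ R, lab n R false p.1 p.2 < lab n R true p.1 p.2 := by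
  rw [isRC_iff, LGood_iff_ww]
  constructor
  · rintro ⟨_, h⟩ p hp
    rw [(lab_at hB p (hB p hp).1).1, (lab_at hB p (hB p hp).1).2]
    exact h p hp
  · intro h
    refine ⟨fun p hp => ⟨(hB p hp).1, (hB p hp).2.2⟩, fun p hp => ?_⟩
    rw [← (lab_at hB p (hB p hp).1).1, ← (lab_at hB p (hB p hp).1).2]
    exact h p hp

theorem LGood.suffix {l l' : List ℤ} (h : LGood (l ++ l')) :
    LGood l' ∧ Inv (pw l') ⊆ Inv (pw (l ++ l')) := by
  induction l with
  | nil => exact ⟨h, subset_rfl⟩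
  | cons j l ih =>
    rw [List.cons_append, LGood] at h
    refine ⟨(ih h.1).1, (ih h.1).2.trans ?_⟩
    rw [List.cons_append, pw_cons, (Inv_up _ _ h.2).1]
    exact Set.subset_insert _ _

/-- splitting a diagram at a crossing -/
theorem ww_split (n : ℤ) (R p) (hp : p ∈ R) :
    ∃ l, ww n R = l ++ letter n p :: ww n (Aft R p.1 p.2) := by
  have h1 : ∀ b ∈ Aft R p.1 p.2, rcOrder p b ∧ p ≠ b := by
    intro b hb
    rw [mem_Aft] at hb
    unfold rcOrder
    refine ⟨by omega, ?_⟩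
    rintro rfl; omega
  rw [← ww_cons n _ _ h1]
  refine ⟨ww n (R \ insert p (Aft R p.1 p.2)), ?_⟩
  rw [← ww_union, Finset.sdiff_union_of_subset]
  · intro q hq
    rw [Finset.mem_insert, mem_Aft] at hq
    rcases hq with rfl | hq
    · exact hp
    · exact hq.1
  · intro a ha b hb
    rw [Finset.mem_sdiff] at ha
    refine ⟨?_, by rintro rfl; exact ha.2 hb⟩
    rw [Finset.mem_insert, mem_Aft, not_or] at ha
    rw [Finset.mem_insert, mem_Aft] at hb
    have h3 : ¬ (a.1 = p.1 ∧ a.2 = p.2) := fun h => ha.2.1 (Prod.ext h.1 h.2)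
    have h4 : ¬ (a.2 < p.2 ∨ (a.2 = p.2 ∧ p.1 < a.1)) := fun h => ha.2.2 ⟨ha.1, h⟩
    unfold rcOrder
    rcases hb with rfl | hb
    · omega
    · omega

theorem inv_of_mem {n : ℕ} {R} (hB : Box n R) (hL : LGood (ww n R)) (p) (hp : p ∈ R) :
    (lab n R false p.1 p.2, lab n R true p.1 p.2) ∈ Inv (wR n R) := by
  rw [(lab_at hB p (hB p hp).1).1, (lab_at hB p (hB p hp).1).2]
  rw [wR_eq]
  obtain ⟨l, hl⟩ := ww_split n R p hp
  rw [hl] at hL ⊢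
  have := hL.suffix
  apply this.2
  rw [pw_cons, (Inv_up _ _ this.1.2).1]
  exact Set.mem_insert _ _

theorem star_mono {n : ℤ} {R} (hS : Star n R) : ∀ (d : ℕ) (a : ℤ), a + d + 1 ≤ 0 →
    wR n R a < wR n R (a + d + 1) := by
  intro d
  induction d with
  | zero => intro a h; have := hS (a + 1) (by push_cast at h; omega); simpa using this
  | succ d ih =>
    intro a h
    push_cast at h ⊢
    have h1 := ih a (by omega)
    have := hS (a + (d + 1) + 1) h
    have e : a + ((d : ℤ) + 1) + 1 - 1 = a + d + 1 := by ring
    rw [e] at this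
    omega

theorem box_of {n : ℕ} {R} (hR : IsRC n R) (hS : Star n R) : Box n R := by
  rw [isRC_iff] at hR
  rcases List.eq_nil_or_concat (R.sort rcOrder) with h | ⟨l, p, h⟩
  · intro q hq
    have : q ∈ R.sort rcOrder := by simpa using hq
    rw [h] at this; simp at this
  · have hL := hR.2
    have hp : p ∈ R := by
      have : p ∈ R.sort rcOrder := by rw [h]; simp
      simpa using this
    have e : ww n R = l.map (letter n) ++ [letter n p] := by
      unfold ww; rw [h]; simp
    rw [e] at hL
    have h2 := hL.suffix
    have h3 : (letter n p, letter n p + 1) ∈ Inv (wR n R) := by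
      rw [wR_eq, e]
      apply h2.2
      simp [Inv, pw, sT_apply]
    have h4 : 1 ≤ p.2 := by
      by_contra hc
      have h5 := hR.1 p hp
      have h6 := hS (letter n p + 1) (by unfold letter; omega)
      have h7 := h3.2
      simp only [add_sub_cancel_right] at h6 h7
      omega
    intro q hq
    refine ⟨(hR.1 q hq).1, ?_, (hR.1 q hq).2⟩
    have hs := Finset.pairwise_sort R rcOrder
    rw [h, List.concat_eq_append, List.pairwise_append] at hs
    have hq' : q ∈ R.sort rcOrder := by simpa using hq
    rw [h, List.concat_eq_append, List.mem_append] at hq'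
    rcases hq' with hq' | hq'
    · have := hs.2.2 q hq' p (by simp)
      unfold rcOrder at this; omega
    · simp at hq'; subst hq'; exact h4

theorem good_of {n : ℕ} {R} (hR : IsRC n R) (hS : Star n R) : Good n R := by
  have hB := box_of hR hS
  refine ⟨hB, ?_⟩
  intro r m hm
  have h1 := (isRC_box hB).1 hR _ hm
  refine ⟨h1, ?_⟩
  by_contra hc
  have h2 := inv_of_mem hB ((isRC_iff _ _).1 hR).2 _ hm
  simp only at h1 h2
  unfold WW at hc
  set a := lab n R true (n - m) r
  set b := lab n R false (n - m) r
  have h3 := star_mono hS (a - b - 1).toNat b (by omega)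
  have e : b + ((a - b - 1).toNat : ℤ) + 1 = a := by omega
  rw [e] at h3
  have h4 := h2.2
  simp only at h4
  omega

theorem exists_coord {n : ℕ} {R} (hB : Box n R) (p) (hp : p ∈ R) :
    ∃ r m : ℕ, 1 ≤ r ∧ r ≤ n ∧ p = ((n : ℤ) - m, (r : ℤ)) ∧ XX n R r m := by
  have := hB p hp
  have e : p = ((n : ℤ) - (((n : ℤ) - p.1).toNat : ℤ), ((p.2.toNat : ℕ) : ℤ)) := by
    ext <;> simp <;> omega
  refine ⟨p.2.toNat, ((n : ℤ) - p.1).toNat, by omega, by omega, e, ?_⟩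
  unfold XX
  rw [← e]; exact hp

theorem Good.isRC {n : ℕ} {R} (hG : Good n R) : IsRC n R := by
  rw [isRC_box hG.1]
  intro p hp
  obtain ⟨r, m, h1, h2, rfl, hx⟩ := exists_coord hG.1 p hp
  exact (hG.2 r m hx).1

/-- two distinct crossings of a good diagram have different label pairs -/
theorem pair_unique_aux {n : ℕ} {R} (hB : Box n R) (hR : IsRC n R) (p q) (hp : p ∈ R) (hq : q ∈ R)
    (h1 : lab n R false p.1 p.2 = lab n R false q.1 q.2)
    (h2 : lab n R true p.1 p.2 = lab n R true q.1 q.2) : ¬ q ∈ Aft R p.1 p.2 := by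
  intro hqp
  rw [(lab_at hB p (hB p hp).1).1, (lab_at hB q (hB q hq).1).1] at h1
  rw [(lab_at hB p (hB p hp).1).2, (lab_at hB q (hB q hq).1).2] at h2
  have hL := ((isRC_iff _ _).1 hR).2
  obtain ⟨l, hl⟩ := ww_split n R p hp
  rw [hl] at hL
  have hL1 := hL.suffix.1
  rw [LGood] at hL1
  have h3 := (Inv_up _ _ hL1.2).2
  apply h3
  rw [h1, h2]
  obtain ⟨l', hl'⟩ := ww_split n (Aft R p.1 p.2) q hqp
  have e : Aft (Aft R p.1 p.2) q.1 q.2 = Aft R q.1 q.2 := by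
    rw [mem_Aft] at hqp
    ext s
    simp only [mem_Aft]
    constructor
    · rintro ⟨⟨h, _⟩, h'⟩; exact ⟨h, h'⟩
    · rintro ⟨h, h'⟩; exact ⟨⟨h, by omega⟩, h'⟩
  rw [e] at hl'
  have hL2 := hL1.1
  rw [hl'] at hL2
  rw [hl']
  apply hL2.suffix.2
  rw [pw_cons, (Inv_up _ _ hL2.suffix.1.2).1]
  exact Set.mem_insert _ _

theorem pair_unique {n : ℕ} {R} (hG : Good n R) {r m r' m' : ℕ} (hp : XX n R r m) (hq : XX n R r' m')
    (h1 : UU n R r m = UU n R r' m') (h2 : WW n R r m = WW n R r' m') : r = r' ∧ m = m' := by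
  have a1 := pair_unique_aux hG.1 hG.isRC _ _ hp hq h1 h2
  have a2 := pair_unique_aux hG.1 hG.isRC _ _ hq hp h1.symm h2.symm
  have hp' : ((n : ℤ) - m, (r : ℤ)) ∈ R := hp
  have hq' : ((n : ℤ) - m', (r' : ℤ)) ∈ R := hq
  rw [mem_Aft] at a1 a2
  simp only [hp', hq', true_and] at a1 a2
  omega



theorem swap_conj (w : Equiv.Perm ℤ) (j x : ℤ) :
    w⁻¹ (sT j x) = Equiv.swap (w⁻¹ (j + 1)) (w⁻¹ j) (w⁻¹ x) := by
  rw [sT_apply, Equiv.swap_apply_def]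
  have h : ∀ a b : ℤ, w⁻¹ a = w⁻¹ b ↔ a = b := fun a b => (w⁻¹).injective.eq_iff
  simp only [h]
  split_ifs <;> first | rfl | omega

theorem lab_insert_same {n : ℕ} {B : Finset (ℤ × ℤ)} {p : ℤ × ℤ} (hB : Box n B)
    (hN : Box n (insert p B)) (q : ℤ × ℤ) (hq : q.1 ≤ n) (h : p ∉ Aft (insert p B) q.1 q.2) :
    lab n (insert p B) false q.1 q.2 = lab n B false q.1 q.2 ∧
    lab n (insert p B) true q.1 q.2 = lab n B true q.1 q.2 := by
  have e : Aft (insert p B) q.1 q.2 = Aft B q.1 q.2 := by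
    ext s
    constructor
    · intro hs
      have hne : s ≠ p := by rintro rfl; exact h hs
      rw [mem_Aft, Finset.mem_insert] at hs
      rw [mem_Aft]
      exact ⟨hs.1.resolve_left hne, hs.2⟩
    · intro hs
      rw [mem_Aft] at hs ⊢
      exact ⟨Finset.mem_insert_of_mem hs.1, hs.2⟩
  rw [(lab_at hB q hq).1, (lab_at hB q hq).2, (lab_at hN q hq).1, (lab_at hN q hq).2, e]
  exact ⟨rfl, rfl⟩

theorem lab_insert_swap {n : ℕ} {B : Finset (ℤ × ℤ)} {p : ℤ × ℤ} (hB : Box n B) (hp : p ∉ B)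
    (hN : Box n (insert p B)) (q : ℤ × ℤ) (hq : q.1 ≤ n) (h : p ∈ Aft (insert p B) q.1 q.2) :
    lab n (insert p B) false q.1 q.2 =
      Equiv.swap (lab n B true p.1 p.2) (lab n B false p.1 p.2) (lab n B false q.1 q.2) ∧
    lab n (insert p B) true q.1 q.2 =
      Equiv.swap (lab n B true p.1 p.2) (lab n B false p.1 p.2) (lab n B true q.1 q.2) := by
  have hpn := (hN p (Finset.mem_insert_self _ _)).1
  rw [mem_Aft] at h
  have e1 : ∃ l, ww n (Aft (insert p B) q.1 q.2) = l ++ (letter n p :: ww n (Aft B p.1 p.2)) ∧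
      ww n (Aft B q.1 q.2) = l ++ ww n (Aft B p.1 p.2) := by
    refine ⟨ww n (Aft B q.1 q.2 \ Aft B p.1 p.2), ?_, ?_⟩
    · have h1 : ∀ b ∈ Aft B p.1 p.2, rcOrder p b ∧ p ≠ b := by
        intro b hb
        rw [mem_Aft] at hb
        unfold rcOrder
        refine ⟨by omega, ?_⟩
        rintro rfl; omega
      rw [← ww_cons n _ _ h1, ← ww_union]
      · congr 1
        ext s
        simp only [Finset.mem_union, Finset.mem_sdiff, Finset.mem_insert, mem_Aft]
        constructor
        · rintro ⟨h1 | h1, h2⟩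
          · exact Or.inr (Or.inl h1)
          · by_cases h3 : s.2 < p.2 ∨ s.2 = p.2 ∧ p.1 < s.1
            · exact Or.inr (Or.inr ⟨h1, h3⟩)
            · exact Or.inl ⟨⟨h1, h2⟩, fun h => h3 h.2⟩
        · rintro (⟨⟨h1, h2⟩, _⟩ | h1 | ⟨h1, h2⟩)
          · exact ⟨Or.inr h1, h2⟩
          · subst h1; exact ⟨Or.inl rfl, h.2⟩
          · exact ⟨Or.inr h1, by omega⟩
      · intro s hs b hb
        simp only [Finset.mem_sdiff, mem_Aft] at hs
        simp only [Finset.mem_insert, mem_Aft] at hb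
        have h2 : ¬ (s.2 < p.2 ∨ s.2 = p.2 ∧ p.1 < s.1) := fun h => hs.2 ⟨hs.1.1, h⟩
        have h3 : ¬ (s.1 = p.1 ∧ s.2 = p.2) := fun h => hp (by rw [← Prod.ext h.1 h.2]; exact hs.1.1)
        rcases hb with rfl | hb
        · refine ⟨by unfold rcOrder; omega, ?_⟩
          rintro rfl; exact hp hs.1.1
        · refine ⟨by unfold rcOrder; omega, ?_⟩
          rintro rfl; exact hs.2 hb
    · rw [← ww_union, Finset.sdiff_union_of_subset]
      · intro s hs
        rw [mem_Aft] at hs ⊢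
        exact ⟨hs.1, by omega⟩
      · intro s hs b hb
        simp only [Finset.mem_sdiff, mem_Aft] at hs
        simp only [mem_Aft] at hb
        have h2 : ¬ (s.2 < p.2 ∨ s.2 = p.2 ∧ p.1 < s.1) := fun h => hs.2 ⟨hs.1.1, h⟩
        refine ⟨by unfold rcOrder; omega, ?_⟩
        rintro rfl; exact hs.2 hb
  obtain ⟨l, e1, e2⟩ := e1
  rw [(lab_at hB q hq).1, (lab_at hB q hq).2, (lab_at hN q hq).1, (lab_at hN q hq).2, e1, e2,
    (lab_at hB p hpn).1, (lab_at hB p hpn).2]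
  simp only [pw_app_inv, pw_cons_inv]
  exact ⟨swap_conj _ _ _, swap_conj _ _ _⟩

theorem nobump_vals {S u W o u' p q} (hg : GoodRow S u W) (h : Row S u W o)
    (hs : SwapRel u u' p q) (hnb : ¬ Bump S p q) :
    o (sh S p) = u p ∧ o (sh S q) = u q := by
  constructor
  · unfold sh
    split_ifs with hp
    · exact (h.cross hp).2
    · rw [(h.elbow (elbow_p hg h hs.lt hs.btw hnb hp)).2, (h.elbow hp).1]
  · unfold sh
    split_ifs with hq
    · exact (h.cross hq).2
    · rw [(h.elbow (hg.elbow_next h hq hs.np)).2, (h.elbow hq).1]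

/-- track a strand upwards from row `k`, column `j` -/
def trk (n : ℕ) (B : Finset (ℤ × ℤ)) (k j : ℕ) : ℕ → ℕ
  | 0 => j
  | r + 1 => if r + 1 ≤ k then j else sh (XX n B (r + 1)) (trk n B k j r)

theorem trk_le {n B k j r} (h : r ≤ k) : trk n B k j r = j := by
  cases r with
  | zero => rfl
  | succ r => rw [trk, if_pos h]

theorem trk_succ {n B k j r} (h : k ≤ r) : trk n B k j (r + 1) = sh (XX n B (r + 1)) (trk n B k j r) := by
  rw [trk, if_neg (by omega)]

theorem pos_eq {n m m' r r' : ℕ} : (((n : ℤ) - m, (r : ℤ)) = ((n : ℤ) - m', (r' : ℤ))) ↔ (r = r' ∧ m = m') := by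
  rw [Prod.mk.injEq]; omega

theorem XX_insert {n B k j r m} : XX n (insert ((n : ℤ) - (j : ℕ), ((k : ℕ) : ℤ)) B) r m ↔
    XX n B r m ∨ (r = k ∧ m = j) := by
  unfold XX
  rw [Finset.mem_insert, pos_eq, or_comm]

theorem XX_erase {n B k j r m} : XX n (Finset.erase B ((n : ℤ) - (j : ℕ), ((k : ℕ) : ℤ))) r m ↔
    XX n B r m ∧ ¬ (r = k ∧ m = j) := by
  unfold XX
  rw [Finset.mem_erase, ne_eq, pos_eq, and_comm]

theorem box_insert {n B} (hB : Box n B) {k j : ℕ} (hk : 1 ≤ k) (hkn : k ≤ n) :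
    Box n (insert ((n : ℤ) - (j : ℕ), ((k : ℕ) : ℤ)) B) := by
  intro p hp
  rw [Finset.mem_insert] at hp
  rcases hp with rfl | hp
  · simp; omega
  · exact hB p hp

/-- the chain of rows above an added crossing, before the first bump -/
theorem chain {n B k j} (hG : Good n B) (hk : 1 ≤ k) (hkn : k ≤ n) (hj : ¬ XX n B k j)
    (hW : 0 < WW n B k j) (hU : UU n B k j ≤ 0) (N) (hN : N = insert ((n : ℤ) - (j : ℕ), ((k : ℕ) : ℤ)) B) :
    ∀ r, k ≤ r → (∀ s, k ≤ s → s < r → ¬ Bump (XX n B (s + 1)) (trk n B k j s) (trk n B k (j + 1) s)) →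
      SwapRel (UU n B (r + 1)) (UU n N (r + 1)) (trk n B k j r) (trk n B k (j + 1) r) ∧
      UU n B (r + 1) (trk n B k j r) = WW n B k j ∧
      UU n B (r + 1) (trk n B k (j + 1) r) = UU n B k j ∧
      GoodRow (XX n N r) (UU n N r) (WW n N r) := by
  have hBN : Box n N := by rw [hN]; exact box_insert hG.1 hk hkn
  intro r hr
  induction r, hr using Nat.le_induction with
  | base =>
    intro _
    have hR' := row_of n N k
    have hu : UU n N k = UU n B k := funext fun m =>
      UU_congr hG.1 hBN k (fun r hr m => by rw [hN, XX_insert]; constructor; (rintro (h | h); exact h; omega); exact Or.inl) k hk le_rfl m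
    rw [hu] at hR' ⊢
    have := add_cross (hG.2 k) (row_of n B k) hR' (by rw [WW_zero, WW_zero]) hj hW hU
      (fun m => by rw [hN, XX_insert]; simp)
    rw [trk_le le_rfl, trk_le le_rfl]
    refine ⟨this.1, ((row_of n B k).elbow hj).2, ?_, this.2.1⟩
    rw [((row_of n B k).elbow ((hG.2 k).elbow_next (row_of n B k) hj hU)).2, ((row_of n B k).elbow hj).1]
  | succ r hr ih =>
    intro hnb
    obtain ⟨h1, h2, h3, h4⟩ := ih (fun s hs hs' => hnb s hs (by omega))
    have hb := hnb r hr (by omega)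
    have hX : XX n N (r + 1) = XX n B (r + 1) := funext fun m => propext (by
      rw [hN, XX_insert]; constructor; (rintro (h | h); exact h; omega); exact Or.inl)
    have hR' := row_of n N (r + 1)
    rw [hX] at hR' ⊢
    have := nobump (hG.2 (r + 1)) (row_of n B (r + 1)) hR' (by rw [WW_zero, WW_zero]) h1 hb
    have hv := nobump_vals (hG.2 (r + 1)) (row_of n B (r + 1)) h1 hb
    rw [trk_succ hr, trk_succ hr]
    exact ⟨this.1, by rw [hv.1, h2], by rw [hv.2, h3], this.2.1⟩

theorem sInf_eq_of (A : Set ℤ) (a : ℤ) (h1 : a ∈ A) (h2 : ∀ x ∈ A, a ≤ x) : sInf A = a :=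
  IsLeast.csInf_eq ⟨h1, h2⟩

theorem exists_last (f : ℕ → Prop) (p : ℕ) (h0 : f 0) : ∃ j ≤ p, f j ∧ ∀ m, j < m → m ≤ p → ¬ f m := by
  induction p with
  | zero => exact ⟨0, le_rfl, h0, fun m h h' => by omega⟩
  | succ p ih =>
    by_cases h : f (p + 1)
    · exact ⟨p + 1, le_rfl, h, fun m h h' => by omega⟩
    · obtain ⟨j, h1, h2, h3⟩ := ih
      refine ⟨j, by omega, h2, fun m hm hm' => ?_⟩
      rcases Nat.lt_or_ge p m with h4 | h4
      · obtain rfl : m = p + 1 := by omega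
        exact h
      · exact h3 m hm h4

theorem insertSteps_final (n : ℤ) (fuel R p) (h : IsRC n R) :
    insertSteps n (fuel + 1) R p = [(R, p)] := by
  simp only [insertSteps, if_pos h]

theorem insertSteps_go (n : ℤ) (fuel R p) (h : ¬ IsRC n R) (q : ℤ × ℤ) (i' : ℤ)
    (hC : ∀ s, (s ∈ R ∧ s ≠ p ∧
      ((lab n R true s.1 s.2 = lab n R true p.1 p.2 ∧ lab n R false s.1 s.2 = lab n R false p.1 p.2) ∨
       (lab n R true s.1 s.2 = lab n R false p.1 p.2 ∧ lab n R false s.1 s.2 = lab n R true p.1 p.2))) ↔ s = q)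
    (hi : sInf {x : ℤ | q.1 < x ∧ OpenSpace n (R.erase q) x q.2} = i') :
    insertSteps n (fuel + 1) R p =
      (R, p) :: insertSteps n fuel (insert (i', q.2) (R.erase q)) (i', q.2) := by
  have e : (R.filter fun s => s ≠ p ∧
      ((lab n R true s.1 s.2 = lab n R true p.1 p.2 ∧ lab n R false s.1 s.2 = lab n R false p.1 p.2) ∨
       (lab n R true s.1 s.2 = lab n R false p.1 p.2 ∧ lab n R false s.1 s.2 = lab n R true p.1 p.2))) = {q} := by
    ext s
    rw [Finset.mem_filter, Finset.mem_singleton]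
    exact hC s
  simp only [insertSteps, if_neg h]
  rw [e, Finset.sort_singleton]
  simp only [List.headI_cons, hi]

/-- the result of the main loop -/
structure Loop (n : ℕ) (B : Finset (ℤ × ℤ)) (k j : ℕ) (R' : Finset (ℤ × ℤ)) (P Q : ℕ → ℕ) : Prop where
  box : Box n R'
  below : ∀ r < k, ∀ m, XX n R' r m ↔ XX n B r m
  row : ∀ m, XX n R' k m ↔ XX n B k m ∨ m = j
  hP : P k = j
  hQ : Q k = j + 1
  step : ∀ r, k ≤ r → r + 1 ≤ n →
    RowStep (WW n B (r + 1)) (XX n B (r + 1)) (P r) (Q r) (XX n R' (r + 1)) (P (r + 1)) (Q (r + 1))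

theorem loop (n : ℕ) : ∀ (fuel : ℕ) (B : Finset (ℤ × ℤ)) (k j : ℕ), Good n B → 1 ≤ k → k ≤ n →
    ¬ XX n B k j → 0 < WW n B k j → UU n B k j ≤ 0 → n - k < fuel →
    ∃ P Q R' e, (insertSteps n fuel (insert ((n : ℤ) - (j : ℕ), ((k : ℕ) : ℤ)) B)
        ((n : ℤ) - (j : ℕ), ((k : ℕ) : ℤ))).getLast? = some (R', e) ∧ Loop n B k j R' P Q := by
  intro fuel
  induction fuel with
  | zero => intro B k j _ _ _ _ _ _ h; omega
  | succ fuel ih =>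
    intro B k j hG hk hkn hj hW hU hf
    set p : ℤ × ℤ := ((n : ℤ) - (j : ℕ), ((k : ℕ) : ℤ)) with hp
    set N := insert p B with hN
    have hBN : Box n N := box_insert hG.1 hk hkn
    have hch := chain hG hk hkn hj hW hU N hN
    have hXN : ∀ r m, XX n N r m ↔ XX n B r m ∨ (r = k ∧ m = j) := fun r m => XX_insert
    have hlow : ∀ r, r ≤ k → ∀ m, UU n N r m = UU n B r m := by
      intro r hr m
      rcases Nat.eq_zero_or_pos r with rfl | hr0
      · unfold UU; rw [lab_false_start _ _ _ _ (by simp), lab_false_start _ _ _ _ (by simp)]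
      · exact UU_congr hG.1 hBN k (fun r hr m => by rw [hXN]; constructor; (rintro (h | h); exact h; omega); exact Or.inl) r hr0 hr m
    have hlowW : ∀ r, 1 ≤ r → r < k → ∀ m, WW n N r m = WW n B r m := fun r hr0 hr m =>
      WW_congr r hr0 (fun m => by rw [hXN]; constructor; (rintro (h | h); exact h; omega); exact Or.inl) (fun m => hlow r (by omega) m) m
    by_cases hnb : ∀ s, k ≤ s → s < n → ¬ Bump (XX n B (s + 1)) (trk n B k j s) (trk n B k (j + 1) s)
    · -- no bump at all
      have hGN : Good n N := by
        refine ⟨hBN, fun r => ?_⟩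
        rcases Nat.eq_zero_or_pos r with rfl | hr0
        · intro m hm; exact absurd hm (XX_zero hBN m)
        rcases Nat.lt_or_ge n r with hn | hn
        · intro m hm; exact absurd hm (XX_big hBN hn m)
        rcases Nat.lt_or_ge r k with h1 | h1
        · intro m hm
          rw [hXN] at hm
          rw [hlow r h1.le, hlowW r hr0 h1]
          exact hG.2 r m (by rcases hm with h | h; exact h; omega)
        · exact (hch r h1 (fun s hs hs' => hnb s hs (by omega))).2.2.2
      refine ⟨trk n B k j, trk n B k (j + 1), N, p, ?_, ?_⟩
      · rw [insertSteps_final _ _ _ _ hGN.isRC]; rfl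
      · refine ⟨hBN, ?_, ?_, trk_le le_rfl, trk_le le_rfl, ?_⟩
        · intro r hr m; rw [hXN]; constructor
          · rintro (h | h); exact h; omega
          · exact Or.inl
        · intro m; rw [hXN]; simp
        · intro r hr hrn
          left
          refine ⟨hnb r hr (by omega), ?_, trk_succ hr, trk_succ hr⟩
          intro m; rw [hXN]; constructor
          · rintro (h | h); exact h; omega
          · exact Or.inl
    · push Not at hnb
      have hex : ∃ s, k ≤ s ∧ s < n ∧ Bump (XX n B (s + 1)) (trk n B k j s) (trk n B k (j + 1) s) := hnb
      obtain ⟨r0, ⟨hr0, hr0n, hbump⟩, hmin⟩ : ∃ r0, (k ≤ r0 ∧ r0 < n ∧ Bump (XX n B (r0 + 1)) (trk n B k j r0) (trk n B k (j + 1) r0)) ∧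
          ∀ s < r0, ¬ (k ≤ s ∧ s < n ∧ Bump (XX n B (s + 1)) (trk n B k j s) (trk n B k (j + 1) s)) :=
        ⟨Nat.find hex, Nat.find_spec hex, fun s hs => Nat.find_min hex hs⟩
      have hmin' : ∀ s, k ≤ s → s < r0 → ¬ Bump (XX n B (s + 1)) (trk n B k j s) (trk n B k (j + 1) s) :=
        fun s h1 h2 h3 => hmin s h2 ⟨h1, by omega, h3⟩
      obtain ⟨hsw, hva, hvb, _⟩ := hch r0 hr0 hmin'
      set p0 := trk n B k j r0 with hp0
      set q0 := trk n B k (j + 1) r0 with hq0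
      set k' := r0 + 1 with hk'
      obtain ⟨hbp, hbq, hbe⟩ := hbump
      have hbump : Bump (XX n B k') p0 q0 := ⟨hbp, hbq, hbe⟩
      set ℓ : ℤ × ℤ := ((n : ℤ) - (q0 : ℕ), ((k' : ℕ) : ℤ)) with hℓ
      have hℓB : ℓ ∈ B := hbq
      have hℓN : ℓ ∈ N := Finset.mem_insert_of_mem hℓB
      have hpB : p ∉ B := hj
      have hWℓ : WW n B k' q0 = WW n B k j := by
        rw [hbe, ((row_of n B k').elbow hbp).1, hva]
      have hUℓ : UU n B k' q0 = UU n B k j := hvb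
      have hpℓ : p ∈ Aft N ℓ.1 ℓ.2 := by
        rw [mem_Aft]
        refine ⟨Finset.mem_insert_self _ _, Or.inl ?_⟩
        simp only [hp, hℓ]; omega
      -- N is not reduced
      have hnRC : ¬ IsRC n N := by
        rw [isRC_box hBN]
        intro h
        have h1 := h ℓ hℓN
        have h2 := lab_insert_swap hG.1 hpB hBN ℓ (hG.1 ℓ hℓB).1 hpℓ
        rw [← hN] at h2
        rw [h2.1, h2.2] at h1
        have e1 : lab n B false ℓ.1 ℓ.2 = lab n B false p.1 p.2 := hUℓ
        have e2 : lab n B true ℓ.1 ℓ.2 = lab n B true p.1 p.2 := hWℓ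
        rw [e1, e2, Equiv.swap_apply_left, Equiv.swap_apply_right] at h1
        have e3 : lab n B false p.1 p.2 ≤ 0 := hU
        have e4 : 0 < lab n B true p.1 p.2 := hW
        omega
      -- the other crossing
      have hC : ∀ s, (s ∈ N ∧ s ≠ p ∧
          ((lab n N true s.1 s.2 = lab n N true p.1 p.2 ∧ lab n N false s.1 s.2 = lab n N false p.1 p.2) ∨
           (lab n N true s.1 s.2 = lab n N false p.1 p.2 ∧ lab n N false s.1 s.2 = lab n N true p.1 p.2))) ↔ s = ℓ := by
        have hpp := lab_insert_same hG.1 hBN p (hBN p (Finset.mem_insert_self _ _)).1 (by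
          rw [mem_Aft]; omega)
        rw [← hN] at hpp
        rw [hpp.1, hpp.2]
        have e3 : lab n B false p.1 p.2 ≤ 0 := hU
        have e4 : 0 < lab n B true p.1 p.2 := hW
        have e1 : lab n B false ℓ.1 ℓ.2 = lab n B false p.1 p.2 := hUℓ
        have e2 : lab n B true ℓ.1 ℓ.2 = lab n B true p.1 p.2 := hWℓ
        intro s
        constructor
        · rintro ⟨hs, hsp, hlab⟩
          have hsB : s ∈ B := by
            rw [hN, Finset.mem_insert] at hs; exact hs.resolve_left hsp
          obtain ⟨r, m, hr1, hr2, rfl, hx⟩ := exists_coord hG.1 s hsB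
          have hlt := (hG.2 r m hx).1
          have key : UU n B r m = lab n B false p.1 p.2 ∧ WW n B r m = lab n B true p.1 p.2 := by
            by_cases ha : p ∈ Aft N (((n : ℤ) - m, (r : ℤ)) : ℤ × ℤ).1 (((n : ℤ) - m, (r : ℤ)) : ℤ × ℤ).2
            · have h2 := lab_insert_swap hG.1 hpB hBN _ (hG.1 _ hsB).1 ha
              rw [← hN] at h2
              rw [h2.1, h2.2] at hlab
              change ((Equiv.swap _ _ (WW n B r m) = _ ∧ Equiv.swap _ _ (UU n B r m) = _) ∨ (Equiv.swap _ _ (WW n B r m) = _ ∧ Equiv.swap _ _ (UU n B r m) = _)) at hlab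
              generalize lab n B false p.1 p.2 = b at *
              generalize lab n B true p.1 p.2 = a at *
              generalize WW n B r m = c at *
              generalize UU n B r m = d at *
              have hsa : ∀ x, Equiv.swap a b x = a ↔ x = b := fun x => by
                rw [Equiv.swap_apply_eq_iff, Equiv.swap_apply_left]
              have hsb : ∀ x, Equiv.swap a b x = b ↔ x = a := fun x => by
                rw [Equiv.swap_apply_eq_iff, Equiv.swap_apply_right]
              rw [hsa, hsb, hsa, hsb] at hlab
              omega
            · have h2 := lab_insert_same hG.1 hBN _ (hG.1 _ hsB).1 ha
              rw [← hN] at h2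
              rw [h2.1, h2.2] at hlab
              change ((WW n B r m = _ ∧ UU n B r m = _) ∨ (WW n B r m = _ ∧ UU n B r m = _)) at hlab
              omega
          have := pair_unique hG hx hbq (by rw [key.1, hUℓ]; rfl) (by rw [key.2, hWℓ]; rfl)
          rw [hℓ, pos_eq]; exact this
        · rintro rfl
          refine ⟨hℓN, fun h => hpB (h ▸ hℓB), Or.inr ?_⟩
          have h2 := lab_insert_swap hG.1 hpB hBN ℓ (hG.1 ℓ hℓB).1 hpℓ
          rw [← hN] at h2
          rw [h2.1, h2.2, e1, e2, Equiv.swap_apply_left, Equiv.swap_apply_right]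
          exact ⟨rfl, rfl⟩
      -- the diagram with the crossing removed
      set B' := N.erase ℓ with hB'
      have hBB' : Box n B' := fun s hs => hBN s (Finset.mem_of_mem_erase hs)
      have hXB' : ∀ r m, XX n B' r m ↔ XX n N r m ∧ ¬ (r = k' ∧ m = q0) := fun r m => XX_erase
      have hXlow : ∀ r < k', ∀ m, XX n B' r m ↔ XX n N r m := by
        intro r hr m; rw [hXB']; constructor
        · exact fun h => h.1
        · exact fun h => ⟨h, by omega⟩
      have hXhi : ∀ r > k', ∀ m, XX n B' r m ↔ XX n B r m := by
        intro r hr m; rw [hXB', hXN]; constructor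
        · rintro ⟨h | h, _⟩; exact h; omega
        · exact fun h => ⟨Or.inl h, by omega⟩
      have hXk' : ∀ m, XX n B' k' m ↔ XX n B k' m ∧ m ≠ q0 := by
        intro m; rw [hXB', hXN]; constructor
        · rintro ⟨h | h, h'⟩
          · exact ⟨h, fun h2 => h' ⟨rfl, h2⟩⟩
          · omega
        · exact fun h => ⟨Or.inl h.1, fun h2 => h.2 h2.2⟩
      have hUlow : ∀ r, 1 ≤ r → r ≤ k' → ∀ m, UU n B' r m = UU n N r m :=
        UU_congr hBN hBB' k' hXlow
      have hUk' : UU n B' k' = UU n N k' := funext fun m => hUlow k' (by omega) le_rfl m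
      have hRk' := row_of n B' k'
      rw [hUk'] at hRk'
      have hrem := bump_remove (hG.2 k') (row_of n B k') hRk' (by rw [WW_zero, WW_zero]) hsw hbump hXk'
      have hUhi : ∀ r, k' + 1 ≤ r → ∀ m, UU n B' r m = UU n B r m := by
        intro r hr
        induction r, hr using Nat.le_induction with
        | base => exact hrem.1
        | succ r hr ih2 =>
          intro m
          exact ((row_of n B r).prefix_eq (row_of n B' r) (by rw [WW_zero, WW_zero]) (m + 1)
            (fun m _ => hXhi r (by omega) m) (fun m _ => ih2 m)).2 m (by omega)
      have hWhi : ∀ r, k' + 1 ≤ r → ∀ m, WW n B' r m = WW n B r m := fun r hr m =>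
        WW_congr r (by omega) (hXhi r (by omega)) (hUhi r hr) m
      have hGB' : Good n B' := by
        refine ⟨hBB', fun r => ?_⟩
        rcases Nat.eq_zero_or_pos r with rfl | hr1
        · intro m hm; exact absurd hm (XX_zero hBB' m)
        rcases Nat.lt_trichotomy r k' with h1 | rfl | h1
        · intro m hm
          have hWr : WW n B' r m = WW n N r m := WW_congr r hr1 (hXlow r h1) (hUlow r hr1 h1.le) m
          rw [hUlow r hr1 h1.le, hWr]
          rw [hXlow r h1] at hm
          rcases Nat.lt_or_ge r k with h2 | h2
          · rw [hXN] at hm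
            rw [hlow r h2.le, hlowW r hr1 h2]
            exact hG.2 r m (by rcases hm with h | h; exact h; omega)
          · exact (hch r h2 (fun s hs hs' => hmin' s hs (by omega))).2.2.2 m hm
        · rw [hUk']; exact hrem.2.1
        · intro m hm
          rw [hUhi r h1, hWhi r h1]
          exact hG.2 r m ((hXhi r h1 m).1 hm)
      -- the new position
      obtain ⟨j', hj'1, hj'2, hj'3⟩ := exists_last (fun m => 0 < WW n B k' m) p0 (by
        show 0 < WW n B k' 0
        rw [WW_zero]; omega)
      have hj'4 : ∀ m, j' < m → m ≤ p0 → WW n B k' m ≤ 0 := fun m h1 h2 => not_lt.1 (hj'3 m h1 h2)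
      have hop := bump_open (row_of n B k') hsw hbump hj'1 hj'2 hj'4
      have hjX : ¬ XX n B' k' j' := fun h => hop.1 ((hXk' j').1 h).1
      have hjW : 0 < WW n B' k' j' := by rw [hrem.2.2.1 j' hj'1]; exact hj'2
      have hjU : UU n B' k' j' ≤ 0 := by rw [hUk']; exact hop.2
      have hi : sInf {x : ℤ | ℓ.1 < x ∧ OpenSpace n B' x ℓ.2} = (n : ℤ) - (j' : ℕ) := by
        apply sInf_eq_of
        · refine ⟨?_, ?_, hjX, hjU, hjW⟩
          · simp only [hℓ]; omega
          · omega
        · rintro x ⟨hx1, hx2, hx3, hx4, hx5⟩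
          obtain ⟨m, rfl⟩ : ∃ m : ℕ, x = (n : ℤ) - m := ⟨((n : ℤ) - x).toNat, by omega⟩
          simp only [hℓ] at hx1
          have hmp : m ≤ p0 := by omega
          have h5 : 0 < WW n B' k' m := hx5
          rw [hrem.2.2.1 m hmp] at h5
          by_contra hc
          have := hj'4 m (by omega) hmp
          omega
      obtain ⟨P1, Q1, R', e, hlast, hL⟩ := ih B' k' j' hGB' (by omega) (by omega) hjX hjW hjU (by omega)
      refine ⟨fun r => if r ≤ r0 then trk n B k j r else P1 r, fun r => if r ≤ r0 then trk n B k (j + 1) r else Q1 r, R', e, ?_, ?_⟩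
      · rw [insertSteps_go _ _ _ _ hnRC ℓ _ hC hi, List.getLast?_cons]
        have hlast' : (insertSteps n fuel (insert ((n : ℤ) - (j' : ℕ), ℓ.2) B') ((n : ℤ) - (j' : ℕ), ℓ.2)).getLast? = some (R', e) := hlast
        rw [hlast']; rfl
      · refine ⟨hL.box, ?_, ?_, ?_, ?_, ?_⟩
        · intro r hr m
          rw [hL.below r (by omega), hXlow r (by omega), hXN]; constructor
          · rintro (h | h); exact h; omega
          · exact Or.inl
        · intro m
          rw [hL.below k (by omega), hXlow k (by omega), hXN]; simp
        · simp only [if_pos hr0]; exact trk_le le_rfl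
        · simp only [if_pos hr0]; exact trk_le le_rfl
        · intro r hr hrn
          rcases Nat.lt_trichotomy r r0 with h1 | h1 | h1
          · simp only [if_pos h1.le, if_pos (show r + 1 ≤ r0 from h1)]
            left
            refine ⟨hmin' r hr h1, ?_, trk_succ hr, trk_succ hr⟩
            intro m
            rw [hL.below (r + 1) (by omega), hXlow (r + 1) (by omega), hXN]; constructor
            · rintro (h | h); exact h; omega
            · exact Or.inl
          · subst h1
            simp only [if_pos le_rfl, if_neg (show ¬ (r + 1 ≤ r) by omega)]
            right
            refine ⟨hbump, ?_, ?_, ?_, ?_, ?_⟩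
            · rw [hL.hP]; exact hj'1
            · rw [hL.hP]; exact hj'2
            · rw [hL.hP]; exact hj'4
            · rw [hL.hP, hL.hQ]
            · intro m
              rw [hL.hP, hL.row, hXk']
          · simp only [if_neg (show ¬ r ≤ r0 by omega), if_neg (show ¬ (r + 1 ≤ r0) by omega)]
            have := hL.step r (by omega) hrn
            have e1 : WW n B' (r + 1) = WW n B (r + 1) := funext (hWhi (r + 1) (by omega))
            have e2 : XX n B' (r + 1) = XX n B (r + 1) := funext fun m => propext (hXhi (r + 1) (by omega) m)
            rw [e1, e2] at this
            exact this

theorem exists_bound (n : ℕ) (R : Finset (ℤ × ℤ)) : ∃ M : ℕ, ∀ r m, M ≤ m → ¬ XX n R r m := by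
  refine ⟨R.sup (fun p => ((n : ℤ) - p.1).toNat) + 1, fun r m hm hx => ?_⟩
  have := Finset.le_sup (f := fun p : ℤ × ℤ => ((n : ℤ) - p.1).toNat) hx
  simp only at this
  omega

theorem UU_far {n R} (hB : Box n R) {M : ℕ} (hM : ∀ r m, M ≤ m → ¬ XX n R r m) :
    ∀ r, 1 ≤ r → ∀ m, M + r ≤ m → UU n R r m ≤ 0 ∧ WW n R r (m + 1) ≤ 0 := by
  intro r hr
  induction r, hr using Nat.le_induction with
  | base =>
    intro m hm
    rw [((row_of n R 1).elbow (hM 1 m (by omega))).1, UU_one hB]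
    omega
  | succ r hr ih =>
    intro m hm
    rw [((row_of n R (r + 1)).elbow (hM (r + 1) m (by omega))).1]
    rw [((row_of n R r).elbow (hM r m (by omega))).2]
    obtain ⟨m, rfl⟩ : ∃ m', m = m' + 1 := ⟨m - 1, by omega⟩
    have := (ih m (by omega)).2
    exact ⟨this, this⟩

theorem insertOne_spec {n : ℕ} (R k) (hG : Good n R) (hk : 1 ≤ k) (hkn : k ≤ n) :
    ∃ P Q, Spec n R k (insertOne n R k) P Q := by
  obtain ⟨M, hM⟩ := exists_bound n R
  have hfar := UU_far hG.1 hM k hk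
  obtain ⟨j, hj1, hj2, hj3⟩ := exists_last (fun m => 0 < WW n R k m) (M + k + 1) (by
        show 0 < WW n R k 0
        rw [WW_zero]; omega)
  have hj4 : ∀ m, j < m → WW n R k m ≤ 0 := by
    intro m hm
    rcases Nat.lt_or_ge (M + k + 1) m with h | h
    · obtain ⟨m, rfl⟩ : ∃ m', m = m' + 1 := ⟨m - 1, by omega⟩
      exact (hfar m (by omega)).2
    · exact not_lt.1 (hj3 m hm h)
  have hcr : Create (WW n R k) (XX n R k) (fun m => XX n R k m ∨ m = j) j (j + 1) :=
    ⟨hj2, hj4, rfl, fun m => Iff.rfl⟩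
  have hop := hcr.open_space (row_of n R k)
  have hi : sInf {x : ℤ | OpenSpace n R x k} = (n : ℤ) - (j : ℕ) := by
    apply sInf_eq_of
    · exact ⟨by omega, hop.1, hop.2, hj2⟩
    · rintro x ⟨hx2, hx3, hx4, hx5⟩
      obtain ⟨m, rfl⟩ : ∃ m : ℕ, x = (n : ℤ) - m := ⟨((n : ℤ) - x).toNat, by omega⟩
      have h5 : 0 < WW n R k m := hx5
      by_contra hc
      have := hj4 m (by omega)
      omega
  obtain ⟨P, Q, R', e, hlast, hL⟩ := loop n (((n : ℤ) + 1 - k).toNat + 1) R k j hG hk hkn hop.1 hj2 hop.2 (by omega)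
  have hR' : insertOne n R k = R' := by
    unfold insertOne insertStepsOf
    simp only [hi]
    rw [hlast]; rfl
  rw [hR']
  refine ⟨P, Q, hL.box, hL.below, ?_, hL.step⟩
  rw [hL.hP, hL.hQ]
  exact ⟨hj2, hj4, rfl, hL.row⟩


/-- For every rc-graph `R` satisfying (*) and `0 < x < y ≤ z ≤ n`,
`R ← yxz = R ← yzx`. -/
theorem insert_yxz_eq_yzx (n : ℕ) (hn : 0 < n) (R : Finset (ℤ × ℤ))
    (hR : IsRC n R) (hS : Star n R) (x y z : ℕ)
    (hx : 0 < x) (hxy : x < y) (hyz : y ≤ z) (hzn : z ≤ n) :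
    insertWord n R [y, x, z] = insertWord n R [y, z, x] := by
  exact main_of_spec (fun R k hG hk hkn => insertOne_spec R k hG hk hkn) R (good_of hR hS) x y z hx hxy hyz hzn

end RCGraphs
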